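/- arXiv:1702.08599 — 3 statements merged into one kernel-verified Lean document; each statement's English description precedes it below -/
import Mathlib

section
/- Let m, n, r be positive integers with n ≥ 2 and let p be a prime with p > n+1 and p ∤ m. Then S_n^{(m)}(p^{r+1}) ≡ (−1)^{m−1} · binom(n−2, m−1) · S_n^{(1)}(p^2) · p^{r−1} (mod p^{r+1}). -/
open Finset

attribute [local instance] Classical.propDecidable

/-- `x ≡ y (mod p^s)` for rational numbers `x, y`: the `p`-adic valuation of `x - y`
is at least `s` (where the valuation of `0` is regarded as `+∞`). -/
def padicCong (p s : ℕ) (x y : ℚ) : Prop :=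
  x = y ∨ (s : ℤ) ≤ padicValRat p (x - y)

/-- `Z_n(N,p)`: the sum of `1/(l₁⋯lₙ)` over all ordered `n`-tuples `(l₁,…,lₙ)` of
positive integers not divisible by `p` with `l₁+⋯+lₙ = N`. -/
noncomputable def Zsum (p n N : ℕ) : ℚ :=
  ∑ l ∈ (Finset.Nat.antidiagonalTuple n N).filter
      (fun l => ∀ i, 0 < l i ∧ ¬ p ∣ l i),
    ∏ i, (l i : ℚ)⁻¹

/-- `S_n^{(m)}(p^r)`: the sum of `1/(l₁⋯lₙ)` over all ordered `n`-tuples `(l₁,…,lₙ)` of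
positive integers not divisible by `p`, each `< p^r`, with `l₁+⋯+lₙ = m·p^r`. -/
noncomputable def Ssum (p n m r : ℕ) : ℚ :=
  ∑ l ∈ (Finset.Nat.antidiagonalTuple n (m * p ^ r)).filter
      (fun l => ∀ i, (0 < l i ∧ ¬ p ∣ l i) ∧ l i < p ^ r),
    ∏ i, (l i : ℚ)⁻¹

/-- `σ_n^{(b)}(N,p)`: the sum of `(-1)^(l₁+⋯+l_b)/(l₁⋯lₙ)` over all ordered `n`-tuples
`(l₁,…,lₙ)` of positive integers not divisible by `p` with `l₁+⋯+lₙ = N`. -/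
noncomputable def sigmaSum (p n b N : ℕ) : ℚ :=
  ∑ l ∈ (Finset.Nat.antidiagonalTuple n N).filter
      (fun l => ∀ i, 0 < l i ∧ ¬ p ∣ l i),
    (-1 : ℚ) ^ (∑ i ∈ univ.filter (fun i : Fin n => (i : ℕ) < b), l i) *
      ∏ i, (l i : ℚ)⁻¹

/-- The value of a finite tuple at position `j`, extended by `0`. -/
noncomputable def seqAt {k : ℕ} (u : Fin k → ℕ) (j : ℕ) : ℕ :=
  if h : j < k then u ⟨j, h⟩ else 0

/-- The chain `i₁, i₂, …, i_d, l₁+⋯+l_a` (indexed from `0`): position `j < d` gives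
`i_{j+1}` and position `d` (or beyond) gives `l₁+⋯+l_a`. -/
noncomputable def Fchain {d a : ℕ} (i : Fin d → ℕ) (l : Fin a → ℕ) : ℕ → ℕ :=
  fun j => if h : j < d then i ⟨j, h⟩ else ∑ k, l k

/-- The summation conditions for `F_a^{(b)}(s,N,p)`:
`N > i₁ > ⋯ > i_d > l₁+⋯+l_a`, each `l_k ∈ 𝒫_p`, and
`i₁, i₁-i₂, …, i_{d-1}-i_d, i_d-(l₁+⋯+l_a) ∈ 𝒫_p`.
(When `d = 0` this reduces to `l₁+⋯+l_a < N` and each `l_k ∈ 𝒫_p`.) -/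
def FCond (p : ℕ) {d a : ℕ} (i : Fin d → ℕ) (l : Fin a → ℕ) (N : ℕ) : Prop :=
  (∀ k, 0 < l k ∧ ¬ p ∣ l k) ∧
  Fchain i l 0 < N ∧
  (0 < d → 0 < Fchain i l 0 ∧ ¬ p ∣ Fchain i l 0) ∧
  ∀ j < d, Fchain i l (j + 1) < Fchain i l j ∧
    0 < Fchain i l j - Fchain i l (j + 1) ∧ ¬ p ∣ (Fchain i l j - Fchain i l (j + 1))

/-- `F_a^{(b)}(s,N,p)` where `s = (s₁,…,s_d)` is a vector of signs. -/
noncomputable def Fsum (p a b : ℕ) {d : ℕ} (s : Fin d → ℤ) (N : ℕ) : ℚ :=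
  ∑ il ∈ ((Fintype.piFinset fun _ : Fin d => Finset.range N) ×ˢ
          (Fintype.piFinset fun _ : Fin a => Finset.range N)).filter
      (fun il => FCond p il.1 il.2 N),
    (∏ j, (s j : ℚ) ^ il.1 j) *
      (-1 : ℚ) ^ (∑ k ∈ univ.filter (fun k : Fin a => (k : ℕ) < b), il.2 k) /
      ((∏ j, (il.1 j : ℚ)) * ∏ k, (il.2 k : ℚ))

/-- `A_s`: the total size of the odd-indexed blocks in the decomposition
`s = (X_{w₁}, Z_{w₂}, …, Z_{w_l})`; equivalently, the number of positions `j` such that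
the number of `-1`-entries among `s₁,…,s_j` is even. -/
noncomputable def Acount {d : ℕ} (s : Fin d → ℤ) : ℕ :=
  (univ.filter fun j : Fin d =>
    Even (univ.filter (fun k : Fin d => k ≤ j ∧ s k = -1)).card).card

/-- `B_s`: the total size of the even-indexed blocks in the decomposition
`s = (X_{w₁}, Z_{w₂}, …, Z_{w_l})`; equivalently, the number of positions `j` such that
the number of `-1`-entries among `s₁,…,s_j` is odd. -/
noncomputable def Bcount {d : ℕ} (s : Fin d → ℤ) : ℕ :=
  (univ.filter fun j : Fin d =>
    Odd (univ.filter (fun k : Fin d => k ≤ j ∧ s k = -1)).card).card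

/-- `len(W_s)`: the number of blocks, namely `1` plus the number of `-1`-entries of `s`. -/
noncomputable def lenW {d : ℕ} (s : Fin d → ℤ) : ℕ :=
  1 + (univ.filter fun k : Fin d => s k = -1).card

/-- `P_s` (for given `a ≥ b`): `a - b - A_s` if `len(W_s)` is even, `b - B_s` if odd.
For `s = ∅` this gives `P_∅ = b`. -/
noncomputable def Pval (a b : ℕ) {d : ℕ} (s : Fin d → ℤ) : ℕ :=
  if 2 ∣ lenW s then a - b - Acount s else b - Bcount s

/-- `C_{a,b}(A,B)`, defined via falling factorials `(x)_γ = x(x-1)⋯(x-γ+1)`. -/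
def Cab (a b A B : ℕ) : ℚ :=
  if A = 0 ∧ B = 0 then 1
  else if A = 0 then (b.descFactorial B : ℚ)
  else if B = 0 then ((a - b).descFactorial A : ℚ)
  else ((a - b).descFactorial A : ℚ) * (b.descFactorial B : ℚ)

lemma prod_add_modEq (c : ℤ) (s : Finset ℕ) (f : ℕ → ℤ) :
    (∏ k ∈ s, (c + f k)) ≡ ∏ k ∈ s, f k [ZMOD c] := by
  induction s using Finset.induction_on with
  | empty => simp
  | insert a s ha ih =>
    rw [prod_insert ha, prod_insert ha]
    exact Int.ModEq.mul (by simp [Int.ModEq]) ih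

lemma prod_sub_fact (i : ℕ) : ∏ k ∈ range i, ((k : ℤ) - i) = (-1) ^ i * (i.factorial : ℤ) := by
  rw [← prod_range_reflect, ← prod_range_add_one_eq_factorial]
  push_cast
  have h1 : (-1 : ℤ) ^ i = ∏ _k ∈ range i, (-1 : ℤ) := by simp
  rw [h1, ← prod_mul_distrib]
  refine prod_congr rfl fun k hk => ?_
  have := mem_range.1 hk
  have h : ((i - 1 - k : ℕ) : ℤ) = i - 1 - k := by omega
  rw [h]; ring

lemma choose_mod (p a i e : ℕ) (h : i + 1 ≤ a * p) :
    ((p : ℤ) ^ 2) ∣ ((i + 1 + e).factorial : ℤ) *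
      (((i + 1 + e) + (a * p - (i + 1))).choose (i + 1 + e) : ℕ)
      - a * p * ((-1) ^ i * (i.factorial : ℤ) * (e.factorial : ℤ)) := by
  set t := a * p - (i + 1) with ht
  have ht' : (t : ℤ) = a * p - (i + 1) := by
    rw [ht, Nat.cast_sub h]; push_cast; ring
  have h1 : ((i + 1 + e).factorial : ℤ) * (((i + 1 + e) + t).choose (i + 1 + e) : ℕ)
      = ∏ k ∈ range (i + 1 + e), ((t : ℤ) + 1 + k) := by
    have := Nat.ascFactorial_eq_factorial_mul_choose t (i + 1 + e)
    rw [Nat.ascFactorial_eq_prod_range] at this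
    rw [add_comm t (i + 1 + e)] at this
    have h2 := congrArg (Nat.cast : ℕ → ℤ) this
    push_cast at h2 ⊢
    rw [← h2]
  rw [h1, ht', prod_range_add, prod_range_succ]
  set c : ℤ := a * p with hc
  have hA : (∏ k ∈ range i, (c - (i + 1) + 1 + (k : ℤ))) ≡ (-1) ^ i * (i.factorial : ℤ) [ZMOD c] := by
    rw [← prod_sub_fact]
    rw [prod_congr rfl (fun (k : ℕ) _ => show c - (i + 1) + 1 + (k : ℤ) = c + ((k : ℤ) - i) by ring)]
    exact prod_add_modEq c (range i) (fun k => (k : ℤ) - i)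
  have hB : (∏ k ∈ range e, (c - (i + 1) + 1 + ((i + 1 + k : ℕ) : ℤ))) ≡ (e.factorial : ℤ) [ZMOD c] := by
    rw [← prod_range_add_one_eq_factorial]
    push_cast
    rw [prod_congr rfl (fun (k : ℕ) _ => show c - (i + 1) + 1 + (i + 1 + (k : ℤ)) = c + ((k : ℤ) + 1) by ring)]
    exact prod_add_modEq c (range e) (fun k => (k : ℤ) + 1)
  have hAB := (hA.mul hB).symm.dvd
  have hpc : (p : ℤ) ∣ c := Dvd.intro_left _ rfl
  have : (p : ℤ) ^ 2 ∣ c * ((∏ k ∈ range i, (c - (i + 1) + 1 + (k : ℤ))) *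
      (∏ k ∈ range e, (c - (i + 1) + 1 + ((i + 1 + k : ℕ) : ℤ))) -
        (-1) ^ i * (i.factorial : ℤ) * (e.factorial : ℤ)) := by
    rw [sq]; exact mul_dvd_mul hpc (hpc.trans hAB)
  convert this using 1
  ring

lemma wsum (d m : ℕ) : ∑ i ∈ range (m + 1), (-1 : ℤ) ^ i * ((d + 2).choose i : ℤ) * ((m : ℤ) + 1 - i)
    = (-1) ^ m * (d.choose m : ℤ) := by
  induction m with
  | zero => simp
  | succ m ih =>
    have h := @Int.alternating_sum_range_choose_eq_choose (d + 1) (m + 1)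
    have : ∑ i ∈ range (m + 1 + 1), (-1 : ℤ) ^ i * ((d + 2).choose i : ℤ) * (((m + 1 : ℕ) : ℤ) + 1 - i)
       = ∑ i ∈ range (m + 1 + 1), (-1 : ℤ) ^ i * ((d + 2).choose i : ℤ) +
         ∑ i ∈ range (m + 1), (-1 : ℤ) ^ i * ((d + 2).choose i : ℤ) * ((m : ℤ) + 1 - i) := by
      rw [sum_range_succ, sum_range_succ _ (m + 1), add_right_comm, ← sum_add_distrib]
      congr 1
      · refine sum_congr rfl fun i _ => ?_
        push_cast; ring
      · push_cast; ring
    rw [this, ih, h, Nat.choose_succ_succ]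
    push_cast; ring

/-- number of tuples -/
noncomputable def cnt (p n t : ℕ) : ℕ :=
  ((Fintype.piFinset fun _ : Fin n => range p).filter fun y => ∑ i, y i = t).card

lemma cnt_coeff (p n t : ℕ) :
    (cnt p n t : ℤ) = PowerSeries.coeff t ((∑ i ∈ range p, (PowerSeries.X : PowerSeries ℤ) ^ i) ^ n) := by
  have : ((∑ i ∈ range p, (PowerSeries.X : PowerSeries ℤ) ^ i) ^ n) =
      ∏ _i : Fin n, ∑ i ∈ range p, (PowerSeries.X : PowerSeries ℤ) ^ i := by simp
  rw [this, prod_univ_sum]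
  simp only [prod_pow_eq_pow_sum, map_sum, PowerSeries.coeff_X_pow]
  rw [sum_boole, cnt]
  simp only [eq_comm]

lemma cnt_eq (p d t : ℕ) :
    (cnt p (d + 1) t : ℤ) = ∑ i ∈ range (d + 2), if p * i ≤ t then
      (-1) ^ i * ((d + 1).choose i : ℤ) * ((d + (t - p * i)).choose d : ℕ) else 0 := by
  rw [cnt_coeff]
  have h1 : ((∑ i ∈ range p, (PowerSeries.X : PowerSeries ℤ) ^ i) ^ (d + 1)) =
     (1 - (PowerSeries.X : PowerSeries ℤ) ^ p) ^ (d + 1) * (PowerSeries.invOneSubPow ℤ (d + 1)) := by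
    have h := mul_geom_sum (PowerSeries.X : PowerSeries ℤ) p
    have h' : 1 - (PowerSeries.X : PowerSeries ℤ) ^ p = (1 - PowerSeries.X) * ∑ i ∈ range p, (PowerSeries.X : PowerSeries ℤ) ^ i := by
      linear_combination h
    rw [h', mul_pow, ← PowerSeries.invOneSubPow_inv_eq_one_sub_pow]
    rw [mul_right_comm, (PowerSeries.invOneSubPow ℤ (d + 1)).inv_val, one_mul]
  rw [h1, sub_eq_add_neg, add_comm, add_pow, sum_mul, map_sum]
  refine sum_congr rfl fun i _ => ?_
  rw [PowerSeries.invOneSubPow_val_eq_mk_sub_one_add_choose_of_pos _ _ (Nat.succ_pos d)]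
  rw [neg_pow, one_pow, mul_one, ← pow_mul]
  have : ((-1 : PowerSeries ℤ) ^ i * PowerSeries.X ^ (p * i) * (((d + 1).choose i : ℕ) : PowerSeries ℤ) *
      PowerSeries.mk fun n => (((d + 1 - 1 + n).choose (d + 1 - 1) : ℕ) : ℤ))
      = PowerSeries.C ((-1) ^ i * ((d + 1).choose i : ℤ)) * (PowerSeries.X ^ (p * i) * PowerSeries.mk fun n => (((d + n).choose d : ℕ) : ℤ)) := by
    simp; ring
  rw [this, PowerSeries.coeff_C_mul, PowerSeries.coeff_X_pow_mul']
  simp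

/-- main count of digit tuples modulo the square of the prime. -/
lemma cnt_mod (p i e m : ℕ) (hp : i + 1 + e < p) :
    ((p : ℤ) ^ 2) ∣ ((i + 1 + e).factorial : ℤ) * (cnt p (i + 1 + e + 1) ((m + 1) * p - (i + 1)))
      - p * ((-1) ^ m * ((i + e).choose m : ℤ)) * ((-1) ^ i * (i.factorial : ℤ) * (e.factorial : ℤ)) := by
  set γ := ((-1) ^ i * (i.factorial : ℤ) * (e.factorial : ℤ)) with hγ
  rw [cnt_eq]
  have hw := wsum (i + e) m
  rw [← hw]
  have key : ∀ k, (p * k ≤ (m + 1) * p - (i + 1) ↔ k < m + 1) := by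
    intro k
    constructor
    · intro h
      by_contra hk
      have h2 : p * (m + 1) ≤ p * k := Nat.mul_le_mul_left _ (by omega)
      have h3 : (m + 1) * p = p * (m + 1) := mul_comm _ _
      have h4 : 0 < p * (m + 1) := Nat.mul_pos (by omega) (by omega)
      omega
    · intro h
      have h2 : p * (k + 1) ≤ p * (m + 1) := Nat.mul_le_mul_left _ (by omega)
      have h3 : (m + 1) * p = p * (m + 1) := mul_comm _ _
      rw [mul_add] at h2
      omega
  simp only [key]
  rw [← sum_filter]
  have hs : ∑ k ∈ range (m + 1), (-1 : ℤ) ^ k * ((i + e + 2).choose k : ℤ) * ((m : ℤ) + 1 - k)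
      = ∑ k ∈ (range (i + 1 + e + 2)).filter (fun k => k < m + 1), (-1 : ℤ) ^ k * ((i + 1 + e + 1).choose k : ℤ) * ((m : ℤ) + 1 - k) := by
    symm
    have : i + e + 2 = i + 1 + e + 1 := by ring
    rw [this]
    apply sum_subset
    · intro k; simp
    · intro k hk hk'
      simp only [mem_filter, mem_range, not_and_or] at hk hk'
      rw [Nat.choose_eq_zero_of_lt (by omega)]; simp
  rw [hs, mul_sum, mul_sum, sum_mul, ← sum_sub_distrib]
  refine dvd_sum fun k hk => ?_
  simp only [mem_filter, mem_range] at hk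
  obtain ⟨a, rfl⟩ : ∃ a, m = k + a := ⟨m - k, by omega⟩
  have h1 : (k + a + 1) * p - (i + 1) - p * k = (a + 1) * p - (i + 1) := by
    have : (k + a + 1) * p = p * k + (a + 1) * p := by ring
    omega
  have h2 := choose_mod p (a + 1) i e (by nlinarith)
  rw [h1]
  convert h2.mul_left ((-1) ^ k * ((i + 1 + e + 1).choose k : ℤ)) using 1
  push_cast
  ring

/-- `p^s` divides the rational `x` `p`-adically. -/
def Dv (p s : ℕ) (x : ℚ) : Prop := padicNorm p x ≤ (p : ℚ) ^ (-(s : ℤ))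

section Dlemmas
variable {p : ℕ} [hp : Fact p.Prime]

lemma Dv_add {s : ℕ} {x y : ℚ} (hx : Dv p s x) (hy : Dv p s y) : Dv p s (x + y) :=
  padicNorm.nonarchimedean.trans (max_le hx hy)

lemma Dv_neg {s : ℕ} {x : ℚ} (hx : Dv p s x) : Dv p s (-x) := by
  unfold Dv at *; rwa [padicNorm.neg]

lemma Dv_sub {s : ℕ} {x y : ℚ} (hx : Dv p s x) (hy : Dv p s y) : Dv p s (x - y) := by
  rw [sub_eq_add_neg]; exact Dv_add hx (Dv_neg hy)

lemma Dv_mul {s t : ℕ} {x y : ℚ} (hx : Dv p s x) (hy : Dv p t y) : Dv p (s + t) (x * y) := by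
  unfold Dv at *
  have hp0 : (p : ℚ) ≠ 0 := by exact_mod_cast hp.out.ne_zero
  rw [padicNorm.mul]
  push_cast
  rw [neg_add, zpow_add₀ hp0]
  exact mul_le_mul hx hy (padicNorm.nonneg _) (by positivity)

lemma Dv_mono {s t : ℕ} (h : s ≤ t) {x : ℚ} (hx : Dv p t x) : Dv p s x := by
  refine le_trans hx ?_
  apply zpow_le_zpow_right₀
  · exact_mod_cast hp.out.one_lt.le
  · omega

lemma Dv_sum {ι : Type*} {s : ℕ} {A : Finset ι} {f : ι → ℚ} (h : ∀ i ∈ A, Dv p s (f i)) :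
    Dv p s (∑ i ∈ A, f i) :=
  padicNorm.sum_le' h (by positivity)

lemma Dv_int {s : ℕ} {z : ℤ} (h : (p : ℤ) ^ s ∣ z) : Dv p s (z : ℚ) := by
  apply padicNorm.dvd_iff_norm_le.1; exact_mod_cast h

lemma Dv_nat (z : ℕ) : Dv p 0 (z : ℚ) := by
  have := Dv_int (p := p) (s := 0) (z := (z : ℤ)) (by simp)
  exact_mod_cast this

lemma Dv_pow (s : ℕ) : Dv p s ((p : ℚ) ^ s) := by
  have := Dv_int (p := p) (s := s) (z := (p : ℤ) ^ s) dvd_rfl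
  exact_mod_cast this

lemma Dv_inv {l : ℕ} (h : ¬ p ∣ l) : Dv p 0 ((l : ℚ)⁻¹) := by
  unfold Dv
  have h1 := (padicNorm.nat_eq_one_iff (p := p) l).2 h
  have h2 : (l : ℚ) ≠ 0 := by
    intro h0
    have : l = 0 := by exact_mod_cast h0
    exact h (this ▸ dvd_zero p)
  have h3 : padicNorm p (l : ℚ) * padicNorm p ((l : ℚ)⁻¹) = 1 := by
    rw [← padicNorm.mul, mul_inv_cancel₀ h2, padicNorm.one]
  rw [h1, one_mul] at h3
  rw [h3]; simp

lemma Dv_zero (s : ℕ) : Dv p s 0 := by unfold Dv; simp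

lemma Dv_prod {ι : Type*} {A : Finset ι} {f : ι → ℚ} (h : ∀ i ∈ A, Dv p 0 (f i)) :
    Dv p 0 (∏ i ∈ A, f i) := by
  induction A using Finset.induction_on with
  | empty => simpa using Dv_nat (p := p) 1
  | insert a s ha ih =>
    rw [prod_insert ha]
    exact Dv_mul (s := 0) (t := 0) (h a (mem_insert_self _ _))
      (ih fun i hi => h i (mem_insert_of_mem hi))

lemma Dv_cong {s : ℕ} {x y : ℚ} (hx : Dv p s x) (h : x = y) : Dv p s y := h ▸ hx

lemma not_dvd_shift {r x y : ℕ} (hr : 1 ≤ r) (h : ¬ p ∣ x) : ¬ p ∣ x + p ^ r * y := by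
  rwa [Nat.dvd_add_left ((dvd_pow_self p (by omega)).mul_right y)]

lemma expand {ι : Type*} (A : Finset ι) {r : ℕ} (hr : 1 ≤ r) (x y : ι → ℕ)
    (hx : ∀ i, ¬ p ∣ x i) :
    Dv p (r + 1) (∏ i ∈ A, ((x i + p ^ r * y i : ℕ) : ℚ)⁻¹ -
      (∏ i ∈ A, (x i : ℚ)⁻¹) * (1 - (p : ℚ) ^ r * ∑ i ∈ A, (y i : ℚ) * (x i : ℚ)⁻¹)) := by
  induction A using Finset.induction_on with
  | empty => simpa using Dv_zero (p := p) (r + 1)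
  | insert a s ha ih =>
    rw [prod_insert ha, prod_insert ha, sum_insert ha]
    have hz := not_dvd_shift (y := y a) hr (hx a)
    set z := x a + p ^ r * y a with hzdef
    have hz0 : (z : ℚ) ≠ 0 := by
      intro h0
      have : z = 0 := by exact_mod_cast h0
      exact hz (this ▸ dvd_zero p)
    have hx0 : (x a : ℚ) ≠ 0 := by
      intro h0
      have : x a = 0 := by exact_mod_cast h0
      exact hx a (this ▸ dvd_zero p)
    have hzq : (z : ℚ) = x a + (p : ℚ) ^ r * y a := by rw [hzdef]; push_cast; ring
    have hV : Dv p 0 (∑ i ∈ s, (y i : ℚ) * (x i : ℚ)⁻¹) :=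
      Dv_sum fun i _ => Dv_mul (s := 0) (t := 0) (Dv_nat _) (Dv_inv (hx i))
    have hX : Dv p 0 (∏ i ∈ s, (x i : ℚ)⁻¹) := Dv_prod fun i _ => Dv_inv (hx i)
    set V := ∑ i ∈ s, (y i : ℚ) * (x i : ℚ)⁻¹
    set X := ∏ i ∈ s, (x i : ℚ)⁻¹
    set B := ∏ i ∈ s, ((x i + p ^ r * y i : ℕ) : ℚ)⁻¹
    have hxa := Dv_inv (hx a)
    have hza := Dv_inv hz
    have hP := Dv_pow (p := p) r
    have hy := Dv_nat (p := p) (y a)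
    have t1 := Dv_mul (Dv_inv hz) ih
    have sq : Dv p (r + r) ((p : ℚ) ^ r * (p : ℚ) ^ r) := Dv_mul hP hP
    have t2 : Dv p (r + 1) ((p : ℚ) ^ r * (p : ℚ) ^ r * ((y a : ℚ) * (y a : ℚ) * ((x a : ℚ)⁻¹ * (x a : ℚ)⁻¹) * (z : ℚ)⁻¹ * (X * (1 - (p : ℚ) ^ r * V)))) := by
      refine Dv_mono (by omega) (Dv_mul (t := 0) sq ?_)
      refine Dv_mul (s := 0) (t := 0) (Dv_mul (s := 0) (t := 0) (Dv_mul (s := 0) (t := 0) (Dv_mul (s := 0) (t := 0) hy hy) (Dv_mul (s := 0) (t := 0) hxa hxa)) hza) (Dv_mul (s := 0) (t := 0) hX (Dv_sub (by simpa using Dv_nat (p := p) 1) ?_))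
      exact Dv_mul (s := 0) (t := 0) (Dv_mono (Nat.zero_le _) hP) hV
    have t3 : Dv p (r + 1) ((p : ℚ) ^ r * (p : ℚ) ^ r * ((x a : ℚ)⁻¹ * X * ((y a : ℚ) * (x a : ℚ)⁻¹ * V))) := by
      refine Dv_mono (by omega) (Dv_mul (t := 0) sq ?_)
      exact Dv_mul (s := 0) (t := 0) (Dv_mul (s := 0) (t := 0) hxa hX) (Dv_mul (s := 0) (t := 0) (Dv_mul (s := 0) (t := 0) hy hxa) hV)
    refine Dv_cong (Dv_add (Dv_add (Dv_mono (by omega) t1) t2) t3) ?_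
    have hz1 : (z : ℚ)⁻¹ = (x a : ℚ)⁻¹ - (p : ℚ) ^ r * y a * (x a : ℚ)⁻¹ * (x a : ℚ)⁻¹
        + (p : ℚ) ^ r * (p : ℚ) ^ r * ((y a : ℚ) * (y a : ℚ) * ((x a : ℚ)⁻¹ * (x a : ℚ)⁻¹) * (z : ℚ)⁻¹) := by
      field_simp
      rw [hzq]; ring
    linear_combination (-(X * (1 - (p : ℚ) ^ r * V))) * hz1

/-- tuples with digits below `p` and given sum -/
noncomputable def Yset (p n t : ℕ) : Finset (Fin n → ℕ) :=
  (Fintype.piFinset fun _ : Fin n => range p).filter fun y => ∑ i, y i = t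

lemma Yset_sum_dvd {n t : ℕ} (hn : ¬ p ∣ n) (hc : p ∣ cnt p n t) (i : Fin n) :
    p ∣ ∑ y ∈ Yset p n t, y i := by
  have hsym : ∀ k : Fin n, ∑ y ∈ Yset p n t, y k = ∑ y ∈ Yset p n t, y i := by
    intro k
    have hmem : ∀ y ∈ Yset p n t, (fun j => y (Equiv.swap i k j)) ∈ Yset p n t := by
      intro y hy
      simp only [Yset, mem_filter, Fintype.mem_piFinset] at hy ⊢
      refine ⟨fun j => hy.1 _, ?_⟩
      rw [← hy.2]
      exact Equiv.sum_comp (Equiv.swap i k) y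
    refine sum_nbij' (fun y j => y (Equiv.swap i k j)) (fun y j => y (Equiv.swap i k j))
      hmem hmem ?_ ?_ ?_
    · intro y _; funext j; simp
    · intro y _; funext j; simp
    · intro y _; simp
  have h1 : ∑ k : Fin n, ∑ y ∈ Yset p n t, y k = t * cnt p n t := by
    rw [sum_comm]
    have : ∀ y ∈ Yset p n t, ∑ k, y k = t := fun y hy => (mem_filter.1 hy).2
    rw [sum_congr rfl this, sum_const, smul_eq_mul, mul_comm]
    rfl
  rw [sum_congr rfl (fun k _ => hsym k), sum_const, card_univ, Fintype.card_fin, smul_eq_mul] at h1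
  have h2 : p ∣ n * ∑ y ∈ Yset p n t, y i := h1 ▸ hc.mul_left t
  exact (hp.out.dvd_mul.1 h2).resolve_left hn

lemma inner {n t r : ℕ} (hr : 1 ≤ r) (hn : ¬ p ∣ n) (hc : p ∣ cnt p n t) (x : Fin n → ℕ)
    (hx : ∀ i, ¬ p ∣ x i) :
    Dv p (r + 1) (∑ y ∈ Yset p n t, ∏ i, ((x i + p ^ r * y i : ℕ) : ℚ)⁻¹
      - (cnt p n t : ℚ) * ∏ i, (x i : ℚ)⁻¹) := by
  have h1 : Dv p (r + 1) (∑ y ∈ Yset p n t, (∏ i, ((x i + p ^ r * y i : ℕ) : ℚ)⁻¹ -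
      (∏ i, (x i : ℚ)⁻¹) * (1 - (p : ℚ) ^ r * ∑ i, (y i : ℚ) * (x i : ℚ)⁻¹))) :=
    Dv_sum fun y _ => expand univ hr x y hx
  have h2 : Dv p (r + 1) ((p : ℚ) ^ r * ((∏ i, (x i : ℚ)⁻¹) *
      ∑ i, ((∑ y ∈ Yset p n t, y i : ℕ) : ℚ) * (x i : ℚ)⁻¹)) := by
    refine Dv_mul (Dv_pow r) (Dv_mono (t := 0 + 1) (by omega) (Dv_mul (Dv_prod fun i _ => Dv_inv (hx i)) ?_))
    refine Dv_sum fun i _ => Dv_mul (s := 1) (t := 0) ?_ (Dv_inv (hx i))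
    have := Dv_int (p := p) (s := 1) (z := ((∑ y ∈ Yset p n t, y i : ℕ) : ℤ))
      (by rw [pow_one]; exact Int.natCast_dvd_natCast.2 (Yset_sum_dvd hn hc i))
    exact_mod_cast this
  refine Dv_cong (Dv_sub h1 h2) ?_
  rw [sum_sub_distrib, ← mul_sum, sum_sub_distrib, ← mul_sum, sum_comm, sum_const]
  simp only [← sum_mul, Nat.cast_sum]
  have : (Yset p n t).card = cnt p n t := rfl
  rw [this, nsmul_eq_mul]
  ring

/-- admissible tuples -/
noncomputable def Aset (p n r : ℕ) : Finset (Fin n → ℕ) :=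
  Fintype.piFinset fun _ : Fin n => (range (p ^ r)).filter (fun l => ¬ p ∣ l)

noncomputable def Sfun (p n m r : ℕ) : ℚ :=
  ∑ l ∈ (Aset p n r).filter (fun l => ∑ i, l i = m * p ^ r), ∏ i, (l i : ℚ)⁻¹

lemma Ssum_eq (n m r : ℕ) : Ssum p n m r = Sfun p n m r := by
  unfold Ssum Sfun
  refine sum_congr ?_ fun _ _ => rfl
  ext l
  simp only [mem_filter, Finset.Nat.mem_antidiagonalTuple, Aset, Fintype.mem_piFinset, mem_range]
  constructor
  · rintro ⟨h1, h2⟩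
    exact ⟨fun i => ⟨(h2 i).2, (h2 i).1.2⟩, h1⟩
  · rintro ⟨h1, h2⟩
    refine ⟨h2, fun i => ⟨⟨Nat.pos_of_ne_zero ?_, (h1 i).2⟩, (h1 i).1⟩⟩
    intro h0
    exact (h1 i).2 (h0 ▸ dvd_zero p)

lemma Sfun_split (n m r : ℕ) (hr : 1 ≤ r) : Sfun p n m (r + 1) =
    ∑ x ∈ Aset p n r, ∑ y ∈ (Fintype.piFinset fun _ : Fin n => range p).filter
      (fun y => ∑ i, (x i + p ^ r * y i) = m * p ^ (r + 1)),
      ∏ i, ((x i + p ^ r * y i : ℕ) : ℚ)⁻¹ := by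
  have hpos : 0 < p ^ r := pow_pos hp.out.pos r
  have hdv : p ∣ p ^ r := dvd_pow_self p (by omega)
  simp_rw [sum_filter]
  rw [← sum_product (s := Aset p n r) (t := Fintype.piFinset fun _ : Fin n => range p)
    (f := fun q => if ∑ i, (q.1 i + p ^ r * q.2 i) = m * p ^ (r + 1) then
      ∏ i, ((q.1 i + p ^ r * q.2 i : ℕ) : ℚ)⁻¹ else 0)]
  unfold Sfun
  rw [sum_filter]
  refine sum_nbij' (fun l => (fun i => l i % p ^ r, fun i => l i / p ^ r))
    (fun q i => q.1 i + p ^ r * q.2 i) ?_ ?_ ?_ ?_ ?_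
  · intro l hl
    simp only [mem_product, Aset, Fintype.mem_piFinset, mem_filter, mem_range] at hl ⊢
    refine ⟨fun i => ⟨Nat.mod_lt _ hpos, ?_⟩, fun i => ?_⟩
    · rw [(Nat.dvd_mod_iff hdv)]; exact (hl i).2
    · rw [Nat.div_lt_iff_lt_mul hpos, mul_comm, ← pow_succ]; exact (hl i).1
  · intro q hq
    simp only [mem_product, Aset, Fintype.mem_piFinset, mem_filter, mem_range] at hq ⊢
    intro i
    refine ⟨?_, not_dvd_shift hr (hq.1 i).2⟩
    have h1 := (hq.1 i).1
    have h2 : p ^ r * (q.2 i + 1) ≤ p ^ r * p := Nat.mul_le_mul_left _ (hq.2 i)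
    rw [pow_succ]; rw [mul_add] at h2; omega
  · intro l _; funext i; exact Nat.mod_add_div _ _
  · intro q hq
    simp only [mem_product, Aset, Fintype.mem_piFinset, mem_filter, mem_range] at hq
    ext i
    · simp [Nat.add_mul_mod_self_left, Nat.mod_eq_of_lt (hq.1 i).1]
    · simp [Nat.add_mul_div_left _ _ hpos, Nat.div_eq_of_lt (hq.1 i).1]
  · intro l _
    simp only [Nat.mod_add_div]

lemma Sfun_rec (d m r : ℕ) (hr : 1 ≤ r) (hn : d + 1 < p)
    (hc : ∀ i < d, p ∣ cnt p (d + 1) ((m + 1) * p - (i + 1))) :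
    Dv p (r + 1) (Sfun p (d + 1) (m + 1) (r + 1) -
      ∑ i ∈ range d, (cnt p (d + 1) ((m + 1) * p - (i + 1)) : ℚ) * Sfun p (d + 1) (i + 1) r) := by
  have hpos : 0 < p ^ r := pow_pos hp.out.pos r
  rw [Sfun_split _ _ _ hr]
  have h1 : ∑ i ∈ range d, (cnt p (d + 1) ((m + 1) * p - (i + 1)) : ℚ) * Sfun p (d + 1) (i + 1) r
      = ∑ x ∈ Aset p (d + 1) r, ∑ i ∈ range d, if ∑ k, x k = (i + 1) * p ^ r then
        (cnt p (d + 1) ((m + 1) * p - (i + 1)) : ℚ) * ∏ k, (x k : ℚ)⁻¹ else 0 := by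
    rw [sum_comm]
    refine sum_congr rfl fun i _ => ?_
    rw [Sfun, sum_filter, mul_sum]
    refine sum_congr rfl fun x _ => ?_
    split_ifs <;> simp
  rw [h1, ← sum_sub_distrib]
  refine Dv_sum fun x hx => ?_
  simp only [Aset, Fintype.mem_piFinset, mem_filter, mem_range] at hx
  have hsum : ∀ y : Fin (d + 1) → ℕ, ∑ i, (x i + p ^ r * y i) = ∑ i, x i + p ^ r * ∑ i, y i := by
    intro y; rw [sum_add_distrib, mul_sum]
  by_cases hdiv : p ^ r ∣ ∑ i, x i
  · obtain ⟨j, hj⟩ := hdiv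
    have hxpos : 0 < ∑ i, x i := by
      refine sum_pos (fun i _ => Nat.pos_of_ne_zero fun h0 => (hx i).2 (h0 ▸ dvd_zero p)) ⟨0, mem_univ _⟩
    have hxlt : ∑ i, x i < (d + 1) * p ^ r := by
      have : ∑ i, x i < ∑ _i : Fin (d + 1), p ^ r :=
        sum_lt_sum_of_nonempty ⟨0, mem_univ _⟩ fun i _ => (hx i).1
      simpa using this
    have hj1 : j ≠ 0 := by rintro rfl; omega
    have hj2 : j < d + 1 := by
      rw [hj, mul_comm] at hxlt
      exact Nat.lt_of_mul_lt_mul_right hxlt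
    obtain ⟨i, rfl⟩ := Nat.exists_eq_succ_of_ne_zero hj1
    have hid : i < d := by omega
    have hle : i + 1 ≤ (m + 1) * p := by nlinarith
    have e1 : (Fintype.piFinset fun _ : Fin (d + 1) => range p).filter
      (fun y => ∑ k, (x k + p ^ r * y k) = (m + 1) * p ^ (r + 1)) = Yset p (d + 1) ((m + 1) * p - (i + 1)) := by
      unfold Yset
      refine filter_congr fun y _ => ?_
      rw [hsum, hj, ← mul_add, show (m + 1) * p ^ (r + 1) = p ^ r * ((m + 1) * p) by ring]
      rw [Nat.mul_right_inj hpos.ne']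
      simp only [Nat.succ_eq_add_one]
      omega
    have e2 : (∑ k ∈ range d, if ∑ k, x k = (k + 1) * p ^ r then
        (cnt p (d + 1) ((m + 1) * p - (k + 1)) : ℚ) * ∏ k, (x k : ℚ)⁻¹ else 0)
        = (cnt p (d + 1) ((m + 1) * p - (i + 1)) : ℚ) * ∏ k, (x k : ℚ)⁻¹ := by
      rw [sum_eq_single i]
      · rw [if_pos (by rw [hj, Nat.succ_eq_add_one]; ring)]
      · intro b _ hb
        rw [if_neg]
        rw [hj, mul_comm, Nat.mul_left_inj hpos.ne']
        omega
      · intro h; exact absurd (mem_range.2 hid) h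
    rw [e1, e2]
    refine inner hr (fun h => ?_) (hc i hid) x fun i => (hx i).2
    have := Nat.le_of_dvd (by omega) h
    omega
  · rw [filter_eq_empty_iff.2, sum_empty, sum_eq_zero, sub_zero]
    · exact Dv_zero _
    · intro i _
      rw [if_neg]
      intro h
      exact hdiv (h ▸ Dvd.intro_left _ rfl)
    · intro y _ h
      rw [hsum, show (m + 1) * p ^ (r + 1) = p ^ r * ((m + 1) * p) by ring] at h
      exact hdiv ((Nat.dvd_add_left (Dvd.intro _ rfl)).1 (h ▸ Dvd.intro _ rfl))

/-- the weight `(-1)^m * binom(q,m)` -/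
def ww (q m : ℕ) : ℚ := (-1) ^ m * (q.choose m : ℚ)

/-- the coefficient `β_i` -/
def bb (q i : ℕ) : ℚ := (-1) ^ i * (i.factorial : ℚ) * ((q - i).factorial : ℚ) * ((q + 1).factorial : ℚ)⁻¹

lemma ww_bb (q i : ℕ) (h : i ≤ q) : bb q i * ww q i = ((q + 1 : ℕ) : ℚ)⁻¹ := by
  unfold bb ww
  have h1 := Nat.choose_mul_factorial_mul_factorial h
  have h2 : ((q.choose i : ℚ)) * i.factorial * (q - i).factorial = q.factorial := by exact_mod_cast h1
  have h3 : ((-1 : ℚ) ^ i) * (-1) ^ i = 1 := by rw [← mul_pow]; simp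
  rw [Nat.factorial_succ]
  have h4 : (q.factorial : ℚ) ≠ 0 := by exact_mod_cast q.factorial_ne_zero
  have h5 : ((q + 1 : ℕ) : ℚ) ≠ 0 := by exact_mod_cast q.succ_ne_zero
  calc _ = (((-1 : ℚ) ^ i) * (-1) ^ i) * ((q.choose i : ℚ) * i.factorial * (q - i).factorial) * (((q + 1) * q.factorial : ℕ) : ℚ)⁻¹ := by ring
    _ = _ := by
      rw [h2, h3, Nat.cast_mul]
      field_simp

lemma not_dvd_fact {q : ℕ} (h : q + 2 < p) : ¬ p ∣ (q + 1).factorial := by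
  rw [hp.out.dvd_factorial]; omega

lemma cnt_dvd {q m i : ℕ} (h : q + 2 < p) (hi : i < q + 1) :
    Dv p 2 ((cnt p (q + 1 + 1) ((m + 1) * p - (i + 1)) : ℚ) - p * ww q m * bb q i) := by
  obtain ⟨e, rfl⟩ : ∃ e, q = i + e := ⟨q - i, by omega⟩
  have h1 := cnt_mod p i e m (by omega)
  have h2 := Dv_int h1
  have h3 := Dv_mul (Dv_inv (not_dvd_fact h)) h2
  refine Dv_cong (Dv_mono (by omega) h3) ?_
  have e1 : i + 1 + e = i + e + 1 := by ring
  have h4 : ((i + e + 1).factorial : ℚ) ≠ 0 := by exact_mod_cast (i + e + 1).factorial_ne_zero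
  rw [e1]
  unfold ww bb
  rw [show i + e - i = e by omega]
  push_cast
  field_simp

lemma ww_int (q m : ℕ) : Dv p 0 (ww q m) := by
  have := Dv_int (p := p) (s := 0) (z := (-1) ^ m * (q.choose m : ℤ)) (by simp)
  unfold ww; exact_mod_cast this

lemma bb_int {q : ℕ} (h : q + 2 < p) (i : ℕ) : Dv p 0 (bb q i) := by
  have := Dv_int (p := p) (s := 0) (z := (-1) ^ i * (i.factorial : ℤ) * ((q - i).factorial : ℤ)) (by simp)
  unfold bb
  refine Dv_mul (s := 0) (t := 0) ?_ (Dv_inv (not_dvd_fact h))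
  exact_mod_cast this

lemma cnt_dvd' {q m i : ℕ} (h : q + 2 < p) (hi : i < q + 1) :
    p ∣ cnt p (q + 1 + 1) ((m + 1) * p - (i + 1)) := by
  have h1 := cnt_dvd (m := m) h hi
  have h2 : Dv p 1 ((p : ℚ) * ww q m * bb q i) := by
    have := Dv_pow (p := p) 1
    rw [pow_one] at this
    exact Dv_mul (t := 0) (Dv_mul (t := 0) this (ww_int q m)) (bb_int h i)
  have h3 := Dv_add (Dv_mono (by omega) h1) h2
  rw [sub_add_cancel] at h3
  have h4 := (padicNorm.dvd_iff_norm_le (p := p) (n := 1) (z := (cnt p (q + 1 + 1) ((m + 1) * p - (i + 1)) : ℤ))).2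
    (by exact_mod_cast h3)
  rw [pow_one] at h4
  exact_mod_cast h4

lemma step {q : ℕ} (h : q + 2 < p) (k m : ℕ) (hS : ∀ i, Dv p k (Sfun p (q + 2) (i + 1) (k + 1))) :
    Dv p (k + 2) (Sfun p (q + 2) (m + 1) (k + 2) -
      p * ww q m * ∑ i ∈ range (q + 1), bb q i * Sfun p (q + 2) (i + 1) (k + 1)) := by
  have h1 := Sfun_rec (p := p) (q + 1) m (k + 1) (by omega) (by omega) (fun i hi => cnt_dvd' h hi)
  have h2 : Dv p (k + 2) (∑ i ∈ range (q + 1), ((cnt p (q + 1 + 1) ((m + 1) * p - (i + 1)) : ℚ) - p * ww q m * bb q i)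
      * Sfun p (q + 2) (i + 1) (k + 1)) :=
    Dv_sum fun i hi => Dv_mono (by omega) (Dv_mul (cnt_dvd h (mem_range.1 hi)) (hS i))
  refine Dv_cong (Dv_add h1 h2) ?_
  simp only [sub_mul, sum_sub_distrib, mul_sum]
  simp only [mul_assoc]
  ring

lemma Sfun_int (n m r : ℕ) : Dv p 0 (Sfun p n m r) := by
  refine Dv_sum fun l hl => Dv_prod fun i _ => Dv_inv ?_
  simp only [Aset, Fintype.mem_piFinset, mem_filter, mem_range] at hl
  exact (hl.1 i).2

lemma main {q : ℕ} (h : q + 2 < p) (k : ℕ) : ∀ m,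
    Dv p (k + 2) (Sfun p (q + 2) (m + 1) (k + 2) - ww q m * Sfun p (q + 2) 1 2 * (p : ℚ) ^ k) := by
  have hp1 : Dv p 1 (p : ℚ) := by simpa using Dv_pow (p := p) 1
  have w0 : ww q 0 = 1 := by simp [ww]
  have hb := fun m => step h 0 m (fun i => Sfun_int _ _ _)
  have hb0 := hb 0
  simp only [zero_add, w0, mul_one] at hb hb0
  have hT : Dv p 1 (Sfun p (q + 2) 1 2) := by
    have : Dv p 1 ((p : ℚ) * ∑ i ∈ range (q + 1), bb q i * Sfun p (q + 2) (i + 1) 1) :=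
      Dv_mul (t := 0) hp1 (Dv_sum fun i _ => Dv_mul (s := 0) (t := 0) (bb_int h i) (Sfun_int _ _ _))
    refine Dv_cong (Dv_add (Dv_mono (by omega) hb0) this) ?_
    ring
  induction k with
  | zero =>
    intro m
    refine Dv_cong (Dv_sub (hb m) (Dv_mul (s := 0) (ww_int q m) (Dv_mono (by omega) hb0))) ?_
    simp only [zero_add, pow_zero]
    ring
  | succ k ih =>
    intro m
    have hS : ∀ i, Dv p (k + 1) (Sfun p (q + 2) (i + 1) (k + 1 + 1)) := by
      intro i
      have h1 : Dv p (k + 1) (ww q i * Sfun p (q + 2) 1 2 * (p : ℚ) ^ k) :=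
        Dv_mono (by omega) (Dv_mul (Dv_mul (s := 0) (ww_int q i) hT) (Dv_pow k))
      refine Dv_cong (Dv_add (Dv_mono (by omega) (ih i)) h1) ?_
      ring
    have h1 := step h (k + 1) m hS
    have h2 : Dv p (k + 2) (∑ i ∈ range (q + 1), bb q i *
        (Sfun p (q + 2) (i + 1) (k + 2) - ww q i * Sfun p (q + 2) 1 2 * (p : ℚ) ^ k)) :=
      Dv_sum fun i _ => Dv_mono (by omega) (Dv_mul (s := 0) (bb_int h i) (ih i))
    have h3 : Dv p (k + 1 + 2) (p * ww q m * (∑ i ∈ range (q + 1), bb q i *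
        (Sfun p (q + 2) (i + 1) (k + 2) - ww q i * Sfun p (q + 2) 1 2 * (p : ℚ) ^ k))) :=
      Dv_mono (by omega) (Dv_mul (Dv_mul (t := 0) hp1 (ww_int q m)) h2)
    have h4 : ∑ i ∈ range (q + 1), bb q i * (ww q i * Sfun p (q + 2) 1 2 * (p : ℚ) ^ k)
        = Sfun p (q + 2) 1 2 * (p : ℚ) ^ k := by
      have : ∀ i ∈ range (q + 1), bb q i * (ww q i * Sfun p (q + 2) 1 2 * (p : ℚ) ^ k)
          = ((q + 1 : ℕ) : ℚ)⁻¹ * (Sfun p (q + 2) 1 2 * (p : ℚ) ^ k) := by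
        intro i hi
        rw [← ww_bb q i (by have := mem_range.1 hi; omega)]; ring
      rw [sum_congr rfl this, sum_const, card_range, nsmul_eq_mul, ← mul_assoc, mul_inv_cancel₀, one_mul]
      exact_mod_cast q.succ_ne_zero
    simp only [mul_sub, sum_sub_distrib] at h3
    rw [h4] at h3
    refine Dv_cong (Dv_add h1 h3) ?_
    rw [pow_succ]
    ring

end Dlemmas

theorem stmt1 (m n r : ℕ) (hm : 1 ≤ m) (hn : 2 ≤ n) (hr : 1 ≤ r)
    (p : ℕ) (hp : p.Prime) (hpn : n + 1 < p) (hpm : ¬ p ∣ m) :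
    padicCong p (r + 1) (Ssum p n m (r + 1))
      ((-1 : ℚ) ^ (m - 1) * ((n - 2).choose (m - 1) : ℚ) * Ssum p n 1 2 *
        (p : ℚ) ^ (r - 1)) := by
  haveI : Fact p.Prime := ⟨hp⟩
  obtain ⟨q, rfl⟩ : ∃ q, n = q + 2 := ⟨n - 2, by omega⟩
  obtain ⟨m, rfl⟩ : ∃ k, m = k + 1 := ⟨m - 1, by omega⟩
  obtain ⟨k, rfl⟩ : ∃ k, r = k + 1 := ⟨r - 1, by omega⟩
  have h := main (p := p) (q := q) (by omega) k m
  rw [← Ssum_eq, ← Ssum_eq] at h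
  simp only [Nat.add_sub_cancel]
  unfold ww at h
  unfold padicCong
  by_cases h0 : Ssum p (q + 2) (m + 1) (k + 1 + 1) -
      (-1 : ℚ) ^ m * (q.choose m : ℚ) * Ssum p (q + 2) 1 2 * (p : ℚ) ^ k = 0
  · left; exact sub_eq_zero.1 h0
  · right
    unfold Dv at h
    rw [padicNorm.eq_zpow_of_nonzero h0] at h
    have h1 := (zpow_le_zpow_iff_right₀ (by exact_mod_cast hp.one_lt : (1 : ℚ) < p)).1 h
    push_cast at h1 ⊢
    omega
end

section
/- Let m, n, r be positive integers with n ≥ 2 and r ≥ 2, and let p be a prime with p > n+1 and p ∤ m. Then R_n^{(m)}(p^r) ≡ m · S_n^{(1)}(p^2) · p^{r−2} (mod p^r). -/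
open Finset

attribute [local instance] Classical.propDecidable

/-- The ring of `p`-integral rational numbers. -/
noncomputable def Oring (p : ℕ) [Fact p.Prime] : Subring ℚ :=
  (PadicInt.subring p).comap (Rat.castHom ℚ_[p])

theorem mem_Oring (p : ℕ) [Fact p.Prime] (x : ℚ) : x ∈ Oring p ↔ ‖(x : ℚ_[p])‖ ≤ 1 := by
  rfl

theorem inv_mem_Oring (p : ℕ) [hp : Fact p.Prime] (d : ℕ) (h : ¬ p ∣ d) :
    ((d : ℚ))⁻¹ ∈ Oring p := by
  rw [mem_Oring]
  have : ‖(d : ℚ_[p])‖ = 1 := Padic.norm_natCast_eq_one_iff.2 ((hp.out.coprime_iff_not_dvd).2 h)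
  push_cast
  rw [norm_inv, this]
  simp

theorem padicCong_of (p : ℕ) [hp : Fact p.Prime] (s : ℕ) (x y z : ℚ) (hz : z ∈ Oring p)
    (h : x - y = (p : ℚ) ^ s * z) : padicCong p s x y := by
  have hp0 : (p : ℚ) ≠ 0 := by exact_mod_cast hp.out.ne_zero
  by_cases h0 : z = 0
  · left
    rw [h0, mul_zero] at h
    linarith
  · right
    rw [h, padicValRat.mul (pow_ne_zero _ hp0) h0, padicValRat.pow,
      padicValRat.self hp.out.one_lt]
    have : 0 ≤ padicValRat p z := by
      rw [mem_Oring, Padic.eq_padicNorm, padicNorm.eq_zpow_of_nonzero h0] at hz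
      have hz' : (p : ℚ) ^ (-padicValRat p z) ≤ 1 := by exact_mod_cast hz
      by_contra hneg
      have : 1 < (p : ℚ) ^ (-padicValRat p z) :=
        one_lt_zpow₀ (by exact_mod_cast hp.out.one_lt) (by lia)
      linarith
    simp [this]

theorem pow_div_factorial_mem (p : ℕ) [hp : Fact p.Prime] (J n : ℕ) (hn : n + 2 ≤ p) :
    (p : ℚ) ^ J / ((J + n).factorial : ℚ) ∈ Oring p := by
  have hle : padicValNat p (J + n).factorial ≤ J := by
    have h1 := sub_one_mul_padicValNat_factorial (p := p) (J + n)
    by_contra hlt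
    push Not at hlt
    obtain ⟨q, rfl⟩ : ∃ q, p = q + 2 := ⟨p - 2, by lia⟩
    have h2 : (q + 2 - 1) * padicValNat (q + 2) (J + n).factorial ≤ J + n := by lia
    have h3 : (q + 1) * (J + 1) ≤ (q + 1) * padicValNat (q + 2) (J + n).factorial :=
      Nat.mul_le_mul_left _ hlt
    have h4 : q + 2 - 1 = q + 1 := by lia
    rw [h4] at h2
    nlinarith
  have hne : (J + n).factorial ≠ 0 := Nat.factorial_ne_zero _
  obtain ⟨d, hd⟩ := pow_padicValNat_dvd (p := p) (n := (J + n).factorial)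
  set v := padicValNat p (J + n).factorial with hv
  have hpd : ¬ p ∣ d := by
    rintro ⟨e, rfl⟩
    apply pow_succ_padicValNat_not_dvd (p := p) hne
    rw [← hv]
    exact ⟨e, by rw [pow_succ]; lia⟩
  have hp0 : (p : ℚ) ≠ 0 := by exact_mod_cast hp.out.ne_zero
  have hd0 : (d : ℚ) ≠ 0 := by
    intro h
    apply hpd
    have : d = 0 := by exact_mod_cast h
    simp [this]
  have e : (p : ℚ) ^ J / ((J + n).factorial : ℚ) = (p : ℚ) ^ (J - v) * (d : ℚ)⁻¹ := by
    rw [hd]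
    push_cast
    rw [div_eq_iff (by positivity)]
    have : (p : ℚ) ^ J = p ^ (J - v) * p ^ v := by rw [← pow_add]; congr 1; lia
    rw [this]
    field_simp
  rw [e]
  exact mul_mem (pow_mem (natCast_mem _ _) _) (inv_mem_Oring p d hpd)

theorem choose_conv (k : ℕ) : ∀ T l : ℕ,
    ∑ i ∈ range (T + 1), i.choose k * (T - i).choose l = (T + 1).choose (k + l + 1) := by
  intro T
  induction T with
  | zero =>
    intro l
    rcases k with _ | k <;> rcases l with _ | l <;>
      simp <;> exact (Nat.choose_eq_zero_of_lt (by lia)).symm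
  | succ T ih =>
    intro l
    rcases l with _ | l
    · have := ih 0
      rw [sum_range_succ]
      simp only [Nat.choose_zero_right, mul_one, add_zero] at this ⊢
      rw [this, Nat.choose_succ_succ (T + 1) k]
      ring
    · rw [sum_range_succ]
      have : ∀ i ∈ range (T + 1), i.choose k * (T + 1 - i).choose (l + 1)
          = i.choose k * (T - i).choose l + i.choose k * (T - i).choose (l + 1) := by
        intro i hi
        have : T + 1 - i = (T - i) + 1 := by
          have := mem_range.1 hi
          lia
        rw [this, Nat.choose_succ_succ]
        ring
      rw [sum_congr rfl this, sum_add_distrib, ih, ih]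
      rw [show k + (l + 1) + 1 = (k + l + 1) + 1 by ring, Nat.choose_succ_succ (T + 1)]
      simp

theorem choose_conv_shift (k M l b : ℕ) (hb : b ≤ l) :
    ∑ i ∈ range (M + 1), i.choose k * (M - i + b).choose l = (M + b + 1).choose (k + l + 1) := by
  rw [← choose_conv]
  have hsub : range (M + 1) ⊆ range (M + b + 1) := range_subset_range.2 (by lia)
  rw [← sum_subset hsub]
  · apply sum_congr rfl
    intro i hi
    have := mem_range.1 hi
    rw [show M - i + b = M + b - i by lia]
  · intro i hi hi'
    simp only [mem_range] at hi hi'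
    rw [Nat.choose_eq_zero_of_lt (n := M + b - i) (by lia), mul_zero]

/-- Functions agreeing on `[0,B]` with a `p`-integral combination of the functions
`M ↦ p^J * choose (M+b) (J+n)`, `b < t`. -/
inductive VV (p B : ℕ) [Fact p.Prime] (n t : ℕ) : (ℕ → ℚ) → Prop
  | gen (c : ℚ) (J b : ℕ) (hc : c ∈ Oring p) (hb : b < t) :
      VV p B n t (fun M => c * (p : ℚ) ^ J * ((M + b).choose (J + n) : ℚ))
  | zero : VV p B n t (fun _ => 0)
  | add (f g : ℕ → ℚ) (hf : VV p B n t f) (hg : VV p B n t g) :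
      VV p B n t (fun M => f M + g M)
  | congr (f g : ℕ → ℚ) (hf : VV p B n t f) (h : ∀ M ≤ B, g M = f M) : VV p B n t g

theorem VV.sum {p B : ℕ} [Fact p.Prime] {n t : ℕ} {ι : Type} (s : Finset ι) (f : ι → ℕ → ℚ)
    (h : ∀ i ∈ s, VV p B n t (f i)) : VV p B n t (fun M => ∑ i ∈ s, f i M) := by
  induction s using Finset.induction_on with
  | empty => simpa using VV.zero
  | insert a s ha ih =>
    simp only [sum_insert ha]
    exact VV.add _ _ (h a (mem_insert_self _ _)) (ih fun i hi => h i (mem_insert_of_mem hi))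

theorem VV.convA {p B : ℕ} [Fact p.Prime] {n t : ℕ} (ht : t ≤ n + 1) {f g : ℕ → ℚ}
    (hf : VV p B 0 1 f) (hg : VV p B n t g) :
    VV p B (n + 1) (t + 1) (fun M => ∑ i ∈ range (M + 1), f i * g (M - i)) := by
  induction hf with
  | zero => simpa using VV.zero
  | add f₁ f₂ _ _ h₁ h₂ =>
    refine VV.congr _ _ (VV.add _ _ h₁ h₂) ?_
    intro M _
    rw [← sum_add_distrib]
    exact sum_congr rfl fun i _ => by ring
  | congr f₁ f₂ _ h h₁ =>
    refine VV.congr _ _ h₁ ?_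
    intro M hM
    refine sum_congr rfl fun i hi => ?_
    have := mem_range.1 hi
    rw [h i (by lia)]
  | gen c k b' hc hb' =>
    obtain rfl : b' = 0 := by lia
    induction hg with
    | zero => simpa using VV.zero
    | add f₁ f₂ _ _ h₁ h₂ =>
      refine VV.congr _ _ (VV.add _ _ h₁ h₂) ?_
      intro M _
      rw [← sum_add_distrib]
      exact sum_congr rfl fun i _ => by ring
    | congr f₁ f₂ _ h h₁ =>
      refine VV.congr _ _ h₁ ?_
      intro M hM
      refine sum_congr rfl fun i hi => ?_
      have := mem_range.1 hi
      rw [h (M - i) (by lia)]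
    | gen e J b he hb =>
      refine VV.congr _ _ (VV.gen (c * e) (k + J) (b + 1) (mul_mem hc he) (by lia)) ?_
      intro M _
      have := choose_conv_shift k M (J + n) b (by lia)
      rw [show M + (b + 1) = M + b + 1 by ring, show k + J + (n + 1) = k + (J + n) + 1 by ring,
        ← this]
      push_cast
      rw [mul_sum]
      refine sum_congr rfl fun i _ => ?_
      simp only [add_zero]
      ring

theorem VV.convB {p B : ℕ} [Fact p.Prime] {n t : ℕ} (ht : t ≤ n + 1) {f g : ℕ → ℚ}
    (hf : VV p B 0 1 f) (hg : VV p B n t g) :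
    VV p B (n + 1) t (fun M => ∑ i ∈ range M, f i * g (M - 1 - i)) := by
  induction hf with
  | zero => simpa using VV.zero
  | add f₁ f₂ _ _ h₁ h₂ =>
    refine VV.congr _ _ (VV.add _ _ h₁ h₂) ?_
    intro M _
    rw [← sum_add_distrib]
    exact sum_congr rfl fun i _ => by ring
  | congr f₁ f₂ _ h h₁ =>
    refine VV.congr _ _ h₁ ?_
    intro M hM
    refine sum_congr rfl fun i hi => ?_
    have := mem_range.1 hi
    rw [h i (by lia)]
  | gen c k b' hc hb' =>
    obtain rfl : b' = 0 := by lia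
    induction hg with
    | zero => simpa using VV.zero
    | add f₁ f₂ _ _ h₁ h₂ =>
      refine VV.congr _ _ (VV.add _ _ h₁ h₂) ?_
      intro M _
      rw [← sum_add_distrib]
      exact sum_congr rfl fun i _ => by ring
    | congr f₁ f₂ _ h h₁ =>
      refine VV.congr _ _ h₁ ?_
      intro M hM
      refine sum_congr rfl fun i hi => ?_
      have := mem_range.1 hi
      rw [h (M - 1 - i) (by lia)]
    | gen e J b he hb =>
      refine VV.congr _ _ (VV.gen (c * e) (k + J) b (mul_mem hc he) (by lia)) ?_
      intro M _
      rcases M with _ | M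
      · rw [Nat.choose_eq_zero_of_lt (n := 0 + b) (by lia)]
        simp
      have := choose_conv_shift k M (J + n) b (by lia)
      rw [show M + 1 + b = M + b + 1 by ring, show k + J + (n + 1) = k + (J + n) + 1 by ring,
        ← this]
      push_cast
      rw [mul_sum]
      refine sum_congr rfl fun i _ => ?_
      simp only [add_zero, Nat.add_sub_cancel]
      ring

theorem int_poly_split (P : Polynomial ℤ) (h : P.eval 0 = 0) (M : ℤ) :
    P.eval M = P.coeff 1 * M + P.divX.divX.eval M * M ^ 2 := by
  have h1 := congrArg (Polynomial.eval M) P.divX_mul_X_add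
  have h2 := congrArg (Polynomial.eval M) P.divX.divX_mul_X_add
  have h3 : P.coeff 0 = 0 := by rw [Polynomial.coeff_zero_eq_eval_zero, h]
  simp only [Polynomial.eval_add, Polynomial.eval_mul, Polynomial.eval_X, Polynomial.eval_C,
    Polynomial.coeff_divX, h3] at h1 h2
  rw [← h1, ← h2]
  ring

theorem VV.expand {p B : ℕ} [Fact p.Prime] {n : ℕ} (hn : n + 2 ≤ p) {f : ℕ → ℚ}
    (hf : VV p B n n f) :
    ∃ C ∈ Oring p, ∀ M ≤ B, ∃ D ∈ Oring p, f M = C * M + D * (M : ℚ) ^ 2 := by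
  induction hf with
  | zero => exact ⟨0, zero_mem _, fun M _ => ⟨0, zero_mem _, by simp⟩⟩
  | add f g _ _ hf hg =>
    obtain ⟨C, hC, h⟩ := hf
    obtain ⟨C', hC', h'⟩ := hg
    refine ⟨C + C', add_mem hC hC', fun M hM => ?_⟩
    obtain ⟨D, hD, e⟩ := h M hM
    obtain ⟨D', hD', e'⟩ := h' M hM
    exact ⟨D + D', add_mem hD hD', by simp only [e, e']; ring⟩
  | congr f g _ hfg hf =>
    obtain ⟨C, hC, h⟩ := hf
    refine ⟨C, hC, fun M hM => ?_⟩
    rw [hfg M hM]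
    exact h M hM
  | gen c J b hc hb =>
    have hq := pow_div_factorial_mem p J n hn
    set P : Polynomial ℤ := (descPochhammer ℤ (J + n)).comp (Polynomial.X + Polynomial.C (b : ℤ))
      with hP
    have hev : ∀ M : ℕ, P.eval (M : ℤ) = ((M + b).descFactorial (J + n) : ℤ) := by
      intro M
      rw [hP, Polynomial.eval_comp, ← descPochhammer_eval_eq_descFactorial]
      simp
    have h0 : P.eval 0 = 0 := by
      have := hev 0
      rw [Nat.descFactorial_of_lt (by lia)] at this
      simpa using this
    refine ⟨c * ((p : ℚ) ^ J / ((J + n).factorial : ℚ)) * (P.coeff 1 : ℤ),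
      mul_mem (mul_mem hc hq) (intCast_mem _ _), fun M _ =>
      ⟨c * ((p : ℚ) ^ J / ((J + n).factorial : ℚ)) * (P.divX.divX.eval (M : ℤ) : ℤ),
      mul_mem (mul_mem hc hq) (intCast_mem _ _), ?_⟩⟩
    have h1 := int_poly_split P h0 M
    rw [hev, Nat.descFactorial_eq_factorial_mul_choose] at h1
    have h2 : ((J + n).factorial : ℚ) * ((M + b).choose (J + n) : ℚ)
        = (P.coeff 1 : ℤ) * M + (P.divX.divX.eval (M : ℤ) : ℤ) * (M : ℚ) ^ 2 := by
      exact_mod_cast h1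
    have hne : ((J + n).factorial : ℚ) ≠ 0 := by exact_mod_cast Nat.factorial_ne_zero _
    have h3 : ((M + b).choose (J + n) : ℚ) = ((P.coeff 1 : ℤ) * M +
        (P.divX.divX.eval (M : ℤ) : ℤ) * (M : ℚ) ^ 2) / ((J + n).factorial : ℚ) := by
      rw [← h2]
      field_simp
    simp only [h3]
    ring

theorem fwdDiff_inv (a p : ℕ) (ha : 0 < a) (k : ℕ) : ∀ y : ℕ,
    (fwdDiff 1)^[k] (fun M : ℕ => ((a + p * M : ℕ) : ℚ)⁻¹) y
      = (-1) ^ k * (k.factorial : ℚ) * (p : ℚ) ^ k *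
        ∏ j ∈ range (k + 1), ((a + p * (y + j) : ℕ) : ℚ)⁻¹ := by
  induction k with
  | zero => intro y; simp
  | succ k ih =>
    intro y
    rw [Function.iterate_succ_apply', fwdDiff, ih, ih]
    rw [prod_range_succ _ (k + 1)]
    have e1 : ∏ j ∈ range (k + 1), ((a + p * (y + 1 + j) : ℕ) : ℚ)⁻¹
        = (∏ j ∈ range k, ((a + p * (y + 1 + j) : ℕ) : ℚ)⁻¹) *
          ((a + p * (y + (k + 1)) : ℕ) : ℚ)⁻¹ := by
      rw [prod_range_succ, show y + 1 + k = y + (k + 1) by ring]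
    have e2 : ∏ j ∈ range (k + 1), ((a + p * (y + j) : ℕ) : ℚ)⁻¹
        = (∏ j ∈ range k, ((a + p * (y + 1 + j) : ℕ) : ℚ)⁻¹) *
          ((a + p * y : ℕ) : ℚ)⁻¹ := by
      rw [prod_range_succ']
      congr 1
      exact prod_congr rfl fun j _ => by rw [show y + (j + 1) = y + 1 + j by ring]
    rw [e1, e2]
    set Q := ∏ j ∈ range k, ((a + p * (y + 1 + j) : ℕ) : ℚ)⁻¹
    have h1 : ((a + p * y : ℕ) : ℚ) ≠ 0 := by
      have : a + p * y ≠ 0 := by lia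
      exact_mod_cast this
    have h2 : ((a + p * (y + (k + 1)) : ℕ) : ℚ) ≠ 0 := by
      have : a + p * (y + (k + 1)) ≠ 0 := by lia
      exact_mod_cast this
    rw [Nat.factorial_succ]
    push_cast at h1 h2 ⊢
    field_simp
    ring

/-- `1/l` if `p ∤ l`, else `0`. -/
noncomputable def uu (p i : ℕ) : ℚ := if p ∣ i then 0 else (i : ℚ)⁻¹

theorem VV.base {p B : ℕ} [hp : Fact p.Prime] (a : ℕ) (ha : ¬ p ∣ a) :
    VV p B 0 1 (fun M => uu p (a + p * M)) := by
  have ha0 : 0 < a := Nat.pos_of_ne_zero (by rintro rfl; simp at ha)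
  have hnd : ∀ j, ¬ p ∣ a + p * j := fun j h => ha ((Nat.dvd_add_left (dvd_mul_right p j)).1 h)
  refine VV.congr _ _ (VV.sum (range (B + 1)) (fun k M =>
    ((-1) ^ k * (k.factorial : ℚ) * ∏ j ∈ range (k + 1), ((a + p * (0 + j) : ℕ) : ℚ)⁻¹) *
      (p : ℚ) ^ k * ((M + 0).choose (k + 0) : ℚ)) ?_) ?_
  · intro k _
    refine VV.gen _ k 0 ?_ one_pos
    refine mul_mem (mul_mem (pow_mem (neg_mem (one_mem _)) _) (natCast_mem _ _)) (prod_mem ?_)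
    intro j _
    exact inv_mem_Oring p _ (hnd _)
  · intro M hM
    have := shift_eq_sum_fwdDiff_iter (1 : ℕ) (fun M : ℕ => ((a + p * M : ℕ) : ℚ)⁻¹) M 0
    simp only [fwdDiff_inv a p ha0] at this
    rw [uu, if_neg (hnd M)]
    simp only [zero_add, smul_eq_mul, mul_one, nsmul_eq_mul] at this ⊢
    rw [this]
    rw [← sum_subset (s₁ := range (M + 1)) (s₂ := range (B + 1)) (range_subset_range.2 (by lia))]
    · refine sum_congr rfl fun k _ => ?_
      simp only [add_zero]
      ring
    · intro k _ hk
      simp only [mem_range] at hk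
      rw [Nat.choose_eq_zero_of_lt (by lia)]
      simp

/-- The `n`-fold convolution power of `uu`. -/
noncomputable def WW (p : ℕ) : ℕ → ℕ → ℚ
  | 0, N => if N = 0 then 1 else 0
  | n + 1, N => ∑ i ∈ range (N + 1), uu p i * WW p n (N - i)

theorem sum_residues (p : ℕ) (h : ℕ → ℚ) (K c : ℕ) (hc : c ≤ p) :
    ∑ i ∈ range (p * K + c), h i
      = ∑ a ∈ range p, ∑ j ∈ range (if a < c then K + 1 else K), h (a + p * j) := by
  have h1 : ∀ K, ∑ i ∈ range (p * K), h i = ∑ a ∈ range p, ∑ j ∈ range K, h (a + p * j) := by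
    intro K
    induction K with
    | zero => simp
    | succ K ih =>
      rw [mul_add, mul_one, sum_range_add, ih, ← sum_add_distrib]
      refine sum_congr rfl fun a _ => ?_
      rw [sum_range_succ, add_comm a (p * K)]
  have h2 : ∑ j ∈ range c, h (p * K + j) = ∑ a ∈ range p, if a < c then h (a + p * K) else 0 := by
    rw [← sum_filter]
    have : (range p).filter (fun a => a < c) = range c := by
      ext a
      simp only [mem_filter, mem_range]
      lia
    rw [this]
    exact sum_congr rfl fun a _ => by rw [add_comm]
  rw [sum_range_add, h1, h2, ← sum_add_distrib]
  refine sum_congr rfl fun a _ => ?_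
  split_ifs
  · rw [sum_range_succ]
  · simp

theorem VV.mono {p B : ℕ} [Fact p.Prime] {n t t' : ℕ} (ht : t ≤ t') {f : ℕ → ℚ}
    (hf : VV p B n t f) : VV p B n t' f := by
  induction hf with
  | zero => exact VV.zero
  | add f g _ _ hf hg => exact VV.add _ _ hf hg
  | congr f g _ h hf => exact VV.congr _ _ hf h
  | gen c J b hc hb => exact VV.gen c J b hc (by lia)

theorem WW_VV (p B : ℕ) [hp : Fact p.Prime] (n : ℕ) : ∀ a < p,
    VV p B n (if a = 0 then n else n + 1) (fun M => WW p (n + 1) (a + p * M)) := by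
  have hp0 : 0 < p := hp.out.pos
  induction n with
  | zero =>
    intro a ha
    have e : ∀ N, WW p 1 N = uu p N := by
      intro N
      simp only [WW]
      rw [sum_eq_single N]
      · simp
      · intro i hi hne
        have := mem_range.1 hi
        rw [if_neg (by lia), mul_zero]
      · simp
    simp only [zero_add, e]
    split_ifs with h0
    · subst h0
      refine VV.congr _ _ VV.zero ?_
      intro M _
      simp [uu]
    · exact VV.base a (fun h => h0 (Nat.eq_zero_of_dvd_of_lt h ha))
  | succ n ih =>
    intro a ha
    refine VV.congr _ _ (VV.sum (range p) (fun a' M =>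
      ∑ j ∈ range (if a' < a + 1 then M + 1 else M),
        uu p (a' + p * j) * WW p (n + 1) (a + p * M - (a' + p * j))) ?_) ?_
    · intro a' ha'
      have ha' := mem_range.1 ha'
      by_cases h0 : a' = 0
      · subst h0
        refine VV.congr _ _ VV.zero ?_
        intro M _
        refine sum_eq_zero fun j _ => ?_
        simp [uu]
      have hb := VV.base (B := B) a' (fun h => h0 (Nat.eq_zero_of_dvd_of_lt h ha'))
      by_cases hle : a' < a + 1
      · simp only [if_pos hle]
        rw [if_neg (by lia)]
        have hg := (ih (a - a') (by lia)).mono (t' := n + 1) (by split_ifs <;> lia)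
        refine VV.congr _ _ (VV.convA le_rfl hb hg) ?_
        intro M _
        refine sum_congr rfl fun j hj => ?_
        have hj := mem_range.1 hj
        obtain ⟨d, rfl⟩ : ∃ d, M = j + d := ⟨M - j, by lia⟩
        congr 2
        rw [show j + d - j = d by lia, mul_add]
        lia
      · simp only [if_neg hle]
        have hg := (ih (a + p - a') (by lia)).mono (t' := n + 1) (by split_ifs <;> lia)
        refine (VV.mono (t := n + 1) (by split_ifs <;> lia)
          (VV.congr _ _ (VV.convB le_rfl hb hg) ?_))
        intro M _
        refine sum_congr rfl fun j hj => ?_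
        have hj := mem_range.1 hj
        obtain ⟨d, rfl⟩ : ∃ d, M = j + d + 1 := ⟨M - j - 1, by lia⟩
        congr 2
        rw [show j + d + 1 - 1 - j = d by lia, mul_add, mul_add]
        lia
    · intro M _
      rw [← sum_residues p (fun i => uu p i * WW p (n + 1) (a + p * M - i)) M (a + 1) (by lia)]
      rw [WW, show p * M + (a + 1) = a + p * M + 1 by ring]

theorem sum_tuple_WW (p : ℕ) : ∀ n N : ℕ,
    ((List.Nat.antidiagonalTuple n N).map (fun l => ∏ i, uu p (l i))).sum = WW p n N := by
  intro n
  induction n with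
  | zero =>
    intro N
    rcases N with _ | N <;> simp [WW]
  | succ n ih =>
    intro N
    rw [List.Nat.antidiagonalTuple, List.map_flatMap, List.flatMap_def, List.sum_flatten]
    simp only [List.map_map, Function.comp_def, Fin.prod_univ_succ, Fin.cons_zero, Fin.cons_succ,
      List.sum_map_mul_left, ih]
    rw [WW, ← Finset.Nat.sum_antidiagonal_eq_sum_range_succ (fun i j => uu p i * WW p n j)]
    rfl

theorem Zsum_eq_WW (p n N : ℕ) : Zsum p n N = WW p n N := by
  rw [← sum_tuple_WW, Zsum, sum_filter]
  have : ((List.Nat.antidiagonalTuple n N).map (fun l => ∏ i, uu p (l i))).sum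
      = ∑ l ∈ Finset.Nat.antidiagonalTuple n N, ∏ i, uu p (l i) := rfl
  rw [this]
  refine sum_congr rfl fun l _ => ?_
  split_ifs with h
  · exact prod_congr rfl fun i _ => by rw [uu, if_neg (h i).2]
  · push Not at h
    obtain ⟨i, hi⟩ := h
    symm
    apply prod_eq_zero (mem_univ i)
    by_cases h0 : 0 < l i
    · rw [uu, if_pos (hi h0)]
    · rw [uu, if_pos]
      simp [show l i = 0 by lia]

theorem Ssum_eq_Zsum (p n : ℕ) (hn : 2 ≤ n) : Ssum p n 1 2 = Zsum p n (p ^ 2) := by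
  rw [Ssum, Zsum, one_mul]
  refine sum_congr ?_ fun _ _ => rfl
  refine filter_congr fun l hl => ?_
  rw [Finset.Nat.mem_antidiagonalTuple] at hl
  refine ⟨fun h i => (h i).1, fun h i => ⟨h i, ?_⟩⟩
  have : Nontrivial (Fin n) := Fin.nontrivial_iff_two_le.2 hn
  obtain ⟨j, hj⟩ := exists_ne i
  have h1 : ∑ k ∈ ({i, j} : Finset (Fin n)), l k ≤ ∑ k, l k :=
    sum_le_sum_of_subset (subset_univ _)
  rw [sum_pair hj.symm, hl] at h1
  have := (h j).1
  lia

theorem stmt3 (m n r : ℕ) (hm : 1 ≤ m) (hn : 2 ≤ n) (hr : 2 ≤ r)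
    (p : ℕ) (hp : p.Prime) (hpn : n + 1 < p) (hpm : ¬ p ∣ m) :
    padicCong p r (Zsum p n (m * p ^ r))
      ((m : ℚ) * Ssum p n 1 2 * (p : ℚ) ^ (r - 2)) := by
  haveI : Fact p.Prime := ⟨hp⟩
  obtain ⟨k, rfl⟩ : ∃ k, n = k + 1 := ⟨n - 1, by lia⟩
  obtain ⟨s, rfl⟩ : ∃ s, r = s + 2 := ⟨r - 2, by lia⟩
  have hV := WW_VV p (m * p ^ (s + 1) + p) k 0 hp.pos
  rw [if_pos rfl] at hV
  obtain ⟨C, hC, h⟩ := VV.expand (by lia) hV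
  obtain ⟨D, hD, e⟩ := h (m * p ^ (s + 1)) (by lia)
  obtain ⟨D', hD', e'⟩ := h p (by lia)
  simp only [zero_add] at e e'
  rw [show p * (m * p ^ (s + 1)) = m * p ^ (s + 2) by ring] at e
  rw [← pow_two] at e'
  refine padicCong_of p (s + 2) _ _ (D * m ^ 2 * p ^ s - m * D') ?_ ?_
  · exact sub_mem (mul_mem (mul_mem hD (pow_mem (natCast_mem _ _) _))
      (pow_mem (natCast_mem _ _) _)) (mul_mem (natCast_mem _ _) hD')
  · rw [Ssum_eq_Zsum p _ hn, Zsum_eq_WW, Zsum_eq_WW, e, e', Nat.add_sub_cancel]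
    push_cast
    ring
end

section
/- Let n ≥ 3 be an odd integer and let p be a prime with p > n+1. Then Σ_{b=1}^{⌊n/2⌋} binom(n, b) · σ_n^{(b)}(2p, p) ≡ (n!/2) · B_{p−n} (mod p). -/
open Finset

attribute [local instance] Classical.propDecidable

/-- `x ∈ p^s ℤ_(p)`. -/
def pI (p s : ℕ) (x : ℚ) : Prop :=
  ∃ a b : ℤ, ¬ (p : ℤ) ∣ b ∧ x * b = (p : ℚ) ^ s * a

section pIsec
variable {p s t : ℕ} {x y : ℚ}

lemma pI_add (hp : p.Prime) (hx : pI p s x) (hy : pI p s y) : pI p s (x + y) := by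
  obtain ⟨a, b, hb, h⟩ := hx
  obtain ⟨c, d, hd, h'⟩ := hy
  refine ⟨a * d + c * b, b * d, ?_, ?_⟩
  · intro hh
    rcases (Nat.prime_iff_prime_int.mp hp).dvd_or_dvd hh with h1 | h1
    · exact hb h1
    · exact hd h1
  · push_cast
    linear_combination (d : ℚ) * h + (b : ℚ) * h'

lemma pI_mul (hp : p.Prime) (hx : pI p s x) (hy : pI p t y) : pI p (s + t) (x * y) := by
  obtain ⟨a, b, hb, h⟩ := hx
  obtain ⟨c, d, hd, h'⟩ := hy
  refine ⟨a * c, b * d, ?_, ?_⟩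
  · intro hh
    rcases (Nat.prime_iff_prime_int.mp hp).dvd_or_dvd hh with h1 | h1
    · exact hb h1
    · exact hd h1
  · push_cast
    rw [pow_add]
    linear_combination (y * d : ℚ) * h + ((p : ℚ) ^ s * a : ℚ) * h'

lemma pI_int (hp : p.Prime) (z : ℤ) : pI p 0 (z : ℚ) := by
  refine ⟨z, 1, ?_, by simp⟩
  intro h
  exact (Nat.prime_iff_prime_int.mp hp).not_isUnit (isUnit_of_dvd_one h)

lemma pI_nat (hp : p.Prime) (z : ℕ) : pI p 0 (z : ℚ) := by
  simpa using pI_int hp (z : ℤ)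

lemma pI_zero (hp : p.Prime) : pI p s 0 := by
  refine ⟨0, 1, ?_, by simp⟩
  intro h
  exact (Nat.prime_iff_prime_int.mp hp).not_isUnit (isUnit_of_dvd_one h)

lemma pI_neg (hx : pI p s x) : pI p s (-x) := by
  obtain ⟨a, b, hb, h⟩ := hx
  exact ⟨-a, b, hb, by push_cast; linear_combination -h⟩

lemma pI_sub (hp : p.Prime) (hx : pI p s x) (hy : pI p s y) : pI p s (x - y) := by
  rw [sub_eq_add_neg]; exact pI_add hp hx (pI_neg hy)

lemma pI_sum (hp : p.Prime) {ι : Type*} (S : Finset ι) (f : ι → ℚ)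
    (h : ∀ i ∈ S, pI p s (f i)) : pI p s (∑ i ∈ S, f i) := by
  classical
  induction S using Finset.induction_on with
  | empty => simpa using pI_zero hp
  | insert a S ha ih =>
    rw [Finset.sum_insert ha]
    exact pI_add hp (h a (by simp)) (ih fun i hi => h i (by simp [hi]))

lemma pI_mono (hst : s ≤ t) (hx : pI p t x) : pI p s x := by
  obtain ⟨a, b, hb, h⟩ := hx
  refine ⟨(p : ℤ) ^ (t - s) * a, b, hb, ?_⟩
  rw [h]; push_cast
  rw [← mul_assoc, ← pow_add]; congr 3; omega

lemma pI_mul0 (hp : p.Prime) (hx : pI p 0 x) (hy : pI p t y) : pI p t (x * y) := by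
  simpa using pI_mul hp hx hy

lemma pI_pow (hp : p.Prime) (k : ℕ) (hk : s ≤ k) : pI p s ((p : ℚ) ^ k) := by
  apply pI_mono hk
  refine ⟨1, 1, ?_, by simp⟩
  intro h
  exact (Nat.prime_iff_prime_int.mp hp).not_isUnit (isUnit_of_dvd_one h)

lemma pI_p (hp : p.Prime) : pI p 1 (p : ℚ) := by
  simpa using pI_pow (s := 1) hp 1 le_rfl

lemma pI_dvd (hp : p.Prime) (z : ℤ) (h : (p : ℤ) ∣ z) : pI p 1 (z : ℚ) := by
  obtain ⟨c, rfl⟩ := h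
  push_cast
  simpa using pI_mul hp (pI_p hp) (pI_int hp c)

lemma pI_cancel (hp : p.Prime) (u : ℤ) (hu : ¬ (p : ℤ) ∣ u) (hx : pI p s (u * x)) :
    pI p s x := by
  obtain ⟨a, b, hb, h⟩ := hx
  refine ⟨a, u * b, ?_, ?_⟩
  · intro hh
    rcases (Nat.prime_iff_prime_int.mp hp).dvd_or_dvd hh with h1 | h1
    · exact hu h1
    · exact hb h1
  · push_cast; linear_combination h

lemma pI_cancel_nat (hp : p.Prime) (u : ℕ) (hu : ¬ p ∣ u) (hx : pI p s (u * x)) :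
    pI p s x :=
  pI_cancel hp (u : ℤ) (by rwa [Int.natCast_dvd_natCast]) (by simpa using hx)

lemma pI_cancel_p (hp : p.Prime) (r : ℕ) (hx : pI p (s + r) ((p : ℚ) ^ r * x)) :
    pI p s x := by
  obtain ⟨a, b, hb, h⟩ := hx
  refine ⟨a, b, hb, ?_⟩
  have hp0 : (p : ℚ) ^ r ≠ 0 := pow_ne_zero _ (by exact_mod_cast hp.ne_zero)
  apply mul_left_cancel₀ hp0
  rw [pow_add] at h
  linear_combination h

lemma pI_val (hp : p.Prime) (hx : pI p s x) : x = 0 ∨ (s : ℤ) ≤ padicValRat p x := by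
  by_cases h0 : x = 0
  · exact Or.inl h0
  right
  have := Fact.mk hp
  obtain ⟨a, b, hb, h⟩ := hx
  have hb0 : (b : ℚ) ≠ 0 := by
    intro hh
    apply hb
    have : b = 0 := by exact_mod_cast hh
    simp [this]
  have hp0 : (p : ℚ) ≠ 0 := by exact_mod_cast hp.ne_zero
  have ha0 : (a : ℚ) ≠ 0 := by
    intro hh
    rw [hh, mul_zero] at h
    exact (mul_ne_zero h0 hb0) h
  have h1 := congrArg (padicValRat p) h
  rw [padicValRat.mul h0 hb0, padicValRat.mul (pow_ne_zero _ hp0) ha0, padicValRat.pow,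
    padicValRat.self hp.one_lt, padicValRat.of_int, padicValRat.of_int,
    padicValInt.eq_zero_of_not_dvd hb] at h1
  have : (0 : ℤ) ≤ (padicValInt p a : ℤ) := by positivity
  push_cast at h1
  linarith

end pIsec
/-- Coefficients of `x(x+1)⋯(x+p-1)`. -/
noncomputable def hc (p k : ℕ) : ℚ := (ascPochhammer ℚ p).coeff k

lemma coeff_ascPoch_nat (N k : ℕ) :
    (ascPochhammer ℚ N).coeff k = ((ascPochhammer ℕ N).coeff k : ℚ) := by
  rw [← ascPochhammer_map (Nat.castRingHom ℚ) N, Polynomial.coeff_map]; rfl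

lemma hc_int {p : ℕ} (hp : p.Prime) (k : ℕ) : pI p 0 (hc p k) := by
  unfold hc; rw [coeff_ascPoch_nat]; exact pI_nat hp _

lemma coeff_comp_X_add (f : Polynomial ℚ) (r : ℚ) (N j : ℕ) (hN : f.natDegree ≤ N) :
    (f.comp (Polynomial.X + Polynomial.C r)).coeff j =
      ∑ k ∈ Finset.range (N + 1), (k.choose j : ℚ) * r ^ (k - j) * f.coeff k := by
  rw [Polynomial.comp, Polynomial.eval₂_eq_sum_range' _ (Nat.lt_succ_of_le hN),
    Polynomial.finsetSum_coeff]
  refine Finset.sum_congr rfl fun k _ => ?_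
  rw [Polynomial.coeff_C_mul, Polynomial.coeff_X_add_C_pow]
  ring

lemma hc_rec (p l : ℕ) :
    ∑ k ∈ Finset.range (p + 1), (k.choose l : ℚ) * hc p k = hc p l + p * hc p (l + 1) := by
  have h : (Polynomial.X : Polynomial ℚ) *
      (ascPochhammer ℚ p).comp (Polynomial.X + Polynomial.C 1) =
      ascPochhammer ℚ p * (Polynomial.X + Polynomial.C (p : ℚ)) := by
    have h1 := ascPochhammer_succ_left ℚ p
    have h2 := ascPochhammer_succ_right ℚ p
    rw [h1] at h2
    simpa using h2
  have h3 := congrArg (fun f => Polynomial.coeff f (l + 1)) h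
  simp only [Polynomial.coeff_X_mul, mul_add, Polynomial.coeff_add, Polynomial.coeff_mul_X,
    Polynomial.coeff_mul_C] at h3
  rw [coeff_comp_X_add _ _ p _ (by rw [ascPochhammer_natDegree])] at h3
  simp only [one_pow, mul_one] at h3
  unfold hc
  rw [h3]; ring

lemma hc_top (p : ℕ) : hc p p = 1 := by
  have h := monic_ascPochhammer ℚ p
  have h2 := h.coeff_natDegree
  rwa [ascPochhammer_natDegree] at h2

lemma choose_cong {p : ℕ} (hp : p.Prime) (m r : ℕ) (h : m + 1 + r ≤ p) :
    (p : ℤ) ∣ ((p - 1 - m).choose r : ℤ) - (-1) ^ r * ((m + r).choose r : ℤ) := by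
  have := Fact.mk hp
  rw [← ZMod.intCast_zmod_eq_zero_iff_dvd _ p] 
  push_cast
  have hr : (r.factorial : ZMod p) ≠ 0 := by
    rw [Ne, ZMod.natCast_eq_zero_iff, hp.dvd_factorial]; omega
  apply mul_left_cancel₀ hr
  rw [mul_zero, mul_sub, sub_eq_zero]
  have e1 : (r.factorial : ZMod p) * ((p - 1 - m).choose r : ZMod p) =
      ((p - 1 - m).descFactorial r : ℕ) := by
    rw [Nat.descFactorial_eq_factorial_mul_choose]; push_cast; rfl
  have e2 : (r.factorial : ZMod p) * ((m + r).choose r : ZMod p) =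
      ((m + 1).ascFactorial r : ℕ) := by
    rw [Nat.ascFactorial_eq_factorial_mul_choose]; push_cast; rfl
  rw [e1, mul_left_comm, e2, Nat.descFactorial_eq_prod_range, Nat.ascFactorial_eq_prod_range]
  push_cast
  rw [← Finset.card_range r, ← Finset.prod_const, Finset.card_range, ← Finset.prod_mul_distrib]
  refine Finset.prod_congr rfl fun i hi => ?_
  have hi' := Finset.mem_range.mp hi
  have : ((p - 1 - m - i : ℕ) : ZMod p) + ((m + 1 + i : ℕ) : ZMod p) = 0 := by
    rw [← Nat.cast_add, show p - 1 - m - i + (m + 1 + i) = p by omega]; simp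
  push_cast at this
  linear_combination this

lemma bern_int {p : ℕ} (hp : p.Prime) (m : ℕ) (hm : m + 2 ≤ p) : pI p 0 (bernoulli' m) := by
  induction m using Nat.strong_induction_on with
  | _ m ih =>
    rw [bernoulli'_def]
    apply pI_sub hp (by simpa using pI_nat hp 1)
    apply pI_sum hp
    intro k hk
    have hk' := Finset.mem_range.mp hk
    apply pI_mul0 hp _ (ih k hk' (by omega))
    have h0 : ((m - k + 1 : ℕ) : ℚ) = (m : ℚ) - k + 1 := by
      push_cast [Nat.cast_sub hk'.le]; ring
    rw [← h0]
    apply pI_cancel_nat hp (m - k + 1)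
    · intro hd
      have := Nat.le_of_dvd (by omega) hd
      omega
    · rw [mul_div_cancel₀]
      · exact pI_nat hp _
      · exact_mod_cast (by omega : m - k + 1 ≠ 0)

lemma bern_sum (q : ℕ) (hq : 2 ≤ q) :
    ∑ m ∈ Finset.range q, (-1 : ℚ) ^ m * (q.choose m : ℚ) * bernoulli' m = 0 := by
  have h := sum_bernoulli q
  rw [if_neg (by omega)] at h
  rw [← h]
  refine Finset.sum_congr rfl fun m _ => ?_
  rw [bernoulli'_eq_bernoulli]
  have : ((-1 : ℚ) ^ m) * (-1) ^ m = 1 := by rw [← mul_pow]; simp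
  linear_combination (q.choose m : ℚ) * bernoulli m * this

/-- The key recursion in the form of a sum over `m = p - k`. -/
lemma hc_rec2 {p : ℕ} (hp : p.Prime) (m0 : ℕ) (h1 : 1 ≤ m0) (h2 : m0 + 2 ≤ p) :
    ∑ m ∈ Finset.range (m0 + 1), ((p - 1 - m).choose (m0 + 1 - m) : ℚ) *
      (((p - m : ℕ) : ℚ) * hc p (p - m) / p) =
      ((p - m0 - 1 : ℕ) : ℚ) * hc p (p - m0) := by
  have hp0 : (p : ℚ) ≠ 0 := by exact_mod_cast hp.ne_zero
  obtain ⟨l, hl⟩ : ∃ l, p = m0 + (l + 2) := ⟨p - m0 - 2, by omega⟩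
  have hr := hc_rec p (l + 1)
  rw [← Finset.sum_range_reflect, show p + 1 = (m0 + 2) + (l + 1) by omega,
    Finset.sum_range_add] at hr
  have hz : ∑ x ∈ Finset.range (l + 1),
      (((m0 + 2 + (l + 1) - 1 - (m0 + 2 + x)).choose (l + 1) : ℕ) : ℚ) *
        hc p (m0 + 2 + (l + 1) - 1 - (m0 + 2 + x)) = 0 := by
    apply Finset.sum_eq_zero
    intro x hx
    have := Finset.mem_range.mp hx
    rw [Nat.choose_eq_zero_of_lt (by omega)]; simp
  rw [hz, add_zero, Finset.sum_range_succ] at hr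
  rw [show m0 + 2 + (l + 1) - 1 - (m0 + 1) = l + 1 by omega, Nat.choose_self] at hr
  have hr2 : ∑ x ∈ Finset.range (m0 + 1),
      (((p - x).choose (l + 1) : ℕ) : ℚ) * hc p (p - x) = p * hc p (l + 2) := by
    rw [show m0 + 2 + (l + 1) - 1 = p by omega] at hr
    push_cast at hr
    linear_combination hr
  rw [show p - m0 - 1 = l + 1 by omega, show p - m0 = l + 2 by omega]
  have : ((l + 1 : ℕ) : ℚ) * hc p (l + 2) = ((l + 1 : ℕ) : ℚ) * (p * hc p (l + 2)) / p := by
    field_simp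
  rw [this, ← hr2, Finset.mul_sum, Finset.sum_div]
  refine Finset.sum_congr rfl fun m hm => ?_
  have hm' := Finset.mem_range.mp hm
  have hch : ((p - m).choose (l + 1)) * (l + 1) = (p - m) * (p - 1 - m).choose (m0 + 1 - m) := by
    have e := Nat.add_one_mul_choose_eq (p - 1 - m) l
    rw [show p - 1 - m + 1 = p - m by omega] at e
    rw [← e, Nat.choose_symm_of_eq_add (by omega : p - 1 - m = l + (m0 + 1 - m))]
  have hch' : ((p - m).choose (l + 1) : ℚ) * ((l + 1 : ℕ) : ℚ) =
      ((p - m : ℕ) : ℚ) * ((p - 1 - m).choose (m0 + 1 - m) : ℚ) := by exact_mod_cast hch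
  linear_combination (-(hc p (p - m)) / p) * hch'

theorem glaisher {p : ℕ} (hp : p.Prime) (m : ℕ) (h1 : 1 ≤ m) (h2 : m + 2 ≤ p) :
    pI p 1 (((p - m : ℕ) : ℚ) * hc p (p - m) / p - bernoulli' m) := by
  have hp0 : (p : ℚ) ≠ 0 := by exact_mod_cast hp.ne_zero
  induction m using Nat.strong_induction_on with
  | _ m0 ih =>
    have hr := hc_rec2 hp m0 h1 h2
    have hb := bern_sum (m0 + 1) (by omega)
    -- congruence for Bernoulli sum
    have hB : pI p 1 (∑ m ∈ Finset.range (m0 + 1),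
        ((p - 1 - m).choose (m0 + 1 - m) : ℚ) * bernoulli' m) := by
      have : ∑ m ∈ Finset.range (m0 + 1),
          ((p - 1 - m).choose (m0 + 1 - m) : ℚ) * bernoulli' m =
          ∑ m ∈ Finset.range (m0 + 1), (((((p - 1 - m).choose (m0 + 1 - m) : ℤ) -
            (-1) ^ (m0 + 1 - m) * ((m + (m0 + 1 - m)).choose (m0 + 1 - m) : ℤ) : ℤ) : ℚ) *
             bernoulli' m) := by
        rw [← sub_eq_zero, ← Finset.sum_sub_distrib]
        rw [← mul_zero ((-1 : ℚ) ^ (m0 + 1)), ← hb, Finset.mul_sum]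
        refine Finset.sum_congr rfl fun m hm => ?_
        have hm' := Finset.mem_range.mp hm
        rw [show m + (m0 + 1 - m) = m0 + 1 by omega, Nat.choose_symm (by omega)]
        have hs : (-1 : ℚ) ^ (m0 + 1) * (-1) ^ m = (-1) ^ (m0 + 1 - m) := by
          conv_lhs => rw [show m0 + 1 = (m0 + 1 - m) + m by omega]
          rw [pow_add, mul_assoc, ← mul_pow]; simp
        push_cast
        rw [← hs]; ring
      rw [this]
      apply pI_sum hp
      intro m hm
      have hm' := Finset.mem_range.mp hm
      rw [mul_comm]
      exact pI_mul0 hp (bern_int hp m (by omega))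
        (pI_dvd hp _ (choose_cong hp m (m0 + 1 - m) (by omega)))
    rw [Finset.sum_range_succ] at hr hB
    rw [show m0 + 1 - m0 = 1 by omega, Nat.choose_one_right] at hr hB
    have hI : pI p 1 (∑ m ∈ Finset.range m0,
        (((p - 1 - m).choose (m0 + 1 - m) : ℕ) : ℚ) *
        ((((p - m : ℕ) : ℚ) * hc p (p - m) / p - bernoulli' m))) := by
      apply pI_sum hp
      intro m hm
      have hm' := Finset.mem_range.mp hm
      apply pI_mul0 hp (pI_nat hp _)
      rcases Nat.eq_zero_or_pos m with h0 | h0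
      · subst h0
        simp only [Nat.sub_zero, hc_top, bernoulli'_zero, mul_one, div_self hp0, sub_self]
        exact pI_zero hp
      · exact ih m hm' h0 (by omega)
    simp only [mul_sub, Finset.sum_sub_distrib] at hI
    rw [show p - m0 - 1 = p - 1 - m0 by omega] at hr
    have h3 := pI_neg (pI_add hp hI hB)
    have h4 : pI p 1 (((p - 1 - m0 : ℕ) : ℚ) *
        (((p - m0 : ℕ) : ℚ) * hc p (p - m0) / p - hc p (p - m0) - bernoulli' m0)) := by
      convert h3 using 1
      linear_combination hr
    have h5 := pI_cancel_nat hp _ (by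
      intro hd
      have := Nat.le_of_dvd (by omega) hd
      omega) h4
    have h6 := pI_mul0 hp (pI_nat hp (p - m0)) h5
    have h7 := pI_mul hp (pI_p hp) (bern_int hp m0 h2)
    apply pI_cancel_nat hp m0 (by
      intro hd
      have := Nat.le_of_dvd (by omega) hd
      omega)
    convert pI_neg (pI_add hp h6 h7) using 1
    have hc1 : ((p - m0 : ℕ) : ℚ) = (p : ℚ) - m0 := by
      rw [Nat.cast_sub (by omega)]
    rw [hc1]
    field_simp
    ring

lemma hc_one {p : ℕ} (hp : p.Prime) : hc p 1 = ((p - 1).factorial : ℚ) := by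
  obtain ⟨q, rfl⟩ : ∃ q, p = q + 1 := ⟨p - 1, by have := hp.pos; omega⟩
  unfold hc
  rw [ascPochhammer_succ_left, Polynomial.coeff_X_mul, Polynomial.coeff_zero_eq_eval_zero,
    Polynomial.eval_comp]
  simp [ascPochhammer_eval_one]

lemma hc_zero {p : ℕ} (hp : p.Prime) : hc p 0 = 0 := by
  unfold hc
  rw [Polynomial.coeff_zero_eq_eval_zero, ascPochhammer_eval_zero, if_neg hp.ne_zero]

lemma hc_one_cong {p : ℕ} (hp : p.Prime) : pI p 1 (hc p 1 + 1) := by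
  have := Fact.mk hp
  rw [hc_one hp]
  have h := ZMod.wilsons_lemma p
  have h2 : (p : ℤ) ∣ (((p - 1).factorial : ℤ) + 1) := by
    rw [← ZMod.intCast_zmod_eq_zero_iff_dvd _ p]
    push_cast
    rw [h]; ring
  simpa using pI_dvd hp _ h2

lemma hc_dvd {p : ℕ} (hp : p.Prime) (k : ℕ) (h1 : 2 ≤ k) (h2 : k < p) : pI p 1 (hc p k) := by
  have hp0 : (p : ℚ) ≠ 0 := by exact_mod_cast hp.ne_zero
  have h := glaisher hp (p - k) (by omega) (by omega)
  rw [show p - (p - k) = k by omega] at h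
  have h3 := pI_add hp (pI_mono (Nat.zero_le 1) h) (bern_int hp (p - k) (by omega))
  rw [sub_add_cancel] at h3
  apply pI_cancel_nat hp k (fun hd => by have := Nat.le_of_dvd (by omega) hd; omega)
  convert pI_mul hp (pI_p hp) h3 using 1
  field_simp

lemma hc_dvd_sq {p : ℕ} (hp : p.Prime) (hp2 : Odd p) (k : ℕ) (h1 : 2 ≤ k) (h2 : k + 3 ≤ p)
    (he : Even k) : pI p 2 (hc p k) := by
  have hp0 : (p : ℚ) ≠ 0 := by exact_mod_cast hp.ne_zero
  have h := glaisher hp (p - k) (by omega) (by omega)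
  rw [show p - (p - k) = k by omega, bernoulli'_eq_zero_of_odd (Nat.Odd.sub_even (by omega) hp2 he)
    (by omega), sub_zero] at h
  apply pI_cancel_nat hp k (fun hd => by have := Nat.le_of_dvd (by omega) hd; omega)
  convert pI_mul hp (pI_p hp) h using 1
  field_simp

/-- Coefficients of `(x+p)(x+p+1)⋯(x+2p-1)`. -/
noncomputable def dc (p j : ℕ) : ℚ :=
  ((ascPochhammer ℚ p).comp (Polynomial.X + Polynomial.C (p : ℚ))).coeff j

lemma dc_eq (p j : ℕ) : dc p j =
    ∑ k ∈ Finset.range (p + 1), (k.choose j : ℚ) * (p : ℚ) ^ (k - j) * hc p k :=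
  coeff_comp_X_add _ _ p _ (by rw [ascPochhammer_natDegree])

lemma dc_cong {p : ℕ} (hp : p.Prime) (j : ℕ) (hj : j + 2 ≤ p) :
    pI p 3 (dc p j - (hc p j + (j + 1) * p * hc p (j + 1) +
      ((j + 2).choose j : ℚ) * p ^ 2 * hc p (j + 2))) := by
  have e : dc p j - (hc p j + (j + 1) * p * hc p (j + 1) +
      ((j + 2).choose j : ℚ) * p ^ 2 * hc p (j + 2)) =
      ∑ k ∈ Finset.range (p + 1), ((k.choose j : ℚ) * (p : ℚ) ^ (k - j) * hc p k -
       ((if k = j then hc p j else 0) + (if k = j + 1 then (j + 1) * p * hc p (j + 1) else 0) +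
        (if k = j + 2 then ((j + 2).choose j : ℚ) * p ^ 2 * hc p (j + 2) else 0))) := by
    rw [Finset.sum_sub_distrib, Finset.sum_add_distrib, Finset.sum_add_distrib,
      Finset.sum_ite_eq', Finset.sum_ite_eq', Finset.sum_ite_eq', ← dc_eq,
      if_pos (by simp; omega), if_pos (by simp; omega), if_pos (by simp; omega)]
  rw [e]
  apply pI_sum hp
  intro k _
  by_cases h0 : k < j
  · rw [Nat.choose_eq_zero_of_lt h0, if_neg (by omega), if_neg (by omega), if_neg (by omega)]
    simpa using pI_zero hp
  by_cases h1 : k = j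
  · subst h1; simpa using pI_zero hp
  by_cases h2 : k = j + 1
  · subst h2; simpa using pI_zero hp
  by_cases h3 : k = j + 2
  · subst h3; simpa using pI_zero hp
  rw [if_neg h1, if_neg h2, if_neg h3]
  simp only [add_zero, sub_zero]
  have h4 := pI_mul hp (pI_pow (s := 3) hp (k - j) (by omega)) (hc_int hp k)
  rw [mul_assoc]
  exact pI_mul0 hp (pI_nat hp _) h4

lemma dc_zero (p : ℕ) : dc p 0 = (p.ascFactorial p : ℚ) := by
  unfold dc
  rw [Polynomial.coeff_zero_eq_eval_zero, Polynomial.eval_comp]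
  rw [← ascPochhammer_nat_eq_ascFactorial, ascPochhammer_eval_cast]
  simp

lemma coeff_asc_two (p n : ℕ) : (ascPochhammer ℚ (2 * p)).coeff n =
    ∑ i ∈ Finset.range (n + 1), hc p i * dc p (n - i) := by
  rw [two_mul, ← ascPochhammer_mul, Polynomial.coeff_mul,
    Finset.Nat.sum_antidiagonal_eq_sum_range_succ_mk]
  simp [hc, dc]

/-- `(p+1)⋯(2p-1)`. -/
noncomputable def ph (p : ℕ) : ℚ := ((p + 1).ascFactorial (p - 1) : ℚ)

lemma dc_zero' {p : ℕ} (hp : p.Prime) : dc p 0 = p * ph p := by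
  rw [dc_zero, ph]
  obtain ⟨q, rfl⟩ : ∃ q, p = q + 1 := ⟨p - 1, by have := hp.pos; omega⟩
  rw [show q + 1 - 1 = q by omega, ← Nat.cast_mul]
  congr 1
  have := Nat.succ_ascFactorial (q + 1) q
  rw [Nat.ascFactorial_succ] at *
  simp at *
  linarith

lemma fact_two {p : ℕ} (hp : p.Prime) : ((2 * p).factorial : ℚ) = 2 * p ^ 2 * hc p 1 * ph p := by
  rw [hc_one hp, ph]
  obtain ⟨q, rfl⟩ : ∃ q, p = q + 1 := ⟨p - 1, by have := hp.pos; omega⟩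
  have h := Nat.factorial_mul_ascFactorial (q + 1) q
  rw [show 2 * (q + 1) = (q + 1 + q) + 1 by ring, Nat.factorial_succ, ← h, Nat.factorial_succ q]
  simp
  ring

/-- The main congruence: the bracket is divisible by `p^3`. -/
lemma bracket {p n : ℕ} (hp : p.Prime) (hn : 3 ≤ n) (hodd : Odd n) (hpn : n + 1 < p) :
    pI p 3 (p * ph p * hc p n - (ascPochhammer ℚ (2 * p)).coeff n + 2 * ph p * hc p (n - 1)
      - p ^ 2 * hc p 1 * ph p * bernoulli (p - n)) := by
  have hp0 : (p : ℚ) ≠ 0 := by exact_mod_cast hp.ne_zero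
  have hp2 : Odd p := hp.odd_of_ne_two (by omega)
  have hB : bernoulli (p - n) = bernoulli' (p - n) :=
    bernoulli_eq_bernoulli'_of_ne_one (by
      intro h; omega)
  rw [hB]
  have hBi := bern_int hp (p - n) (by omega)
  have hph : pI p 1 (ph p - hc p 1) := by
    have h := dc_cong hp 0 (by omega)
    rw [dc_zero' hp, hc_zero hp] at h
    apply pI_cancel_p hp 1
    have h2 := pI_mul hp (pI_pow (s := 2) hp 2 le_rfl) (hc_int hp 2)
    convert pI_add hp (pI_mono (by omega : 2 ≤ 3) h) h2 using 1
    simp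
    ring
  have hd1 : pI p 1 (dc p 1 - hc p 1) := by
    have h := dc_cong hp 1 (by omega)
    have h2 := pI_mul hp (pI_pow (s := 1) hp 1 le_rfl) (pI_mul hp (pI_nat hp 2) (hc_int hp 2))
    have h3 := pI_mul hp (pI_pow (s := 1) hp 2 (by omega)) (pI_mul hp (pI_nat hp 3) (hc_int hp 3))
    convert pI_add hp (pI_add hp (pI_mono (by omega : 1 ≤ 3) h) h2) h3 using 1
    simp
    ring
  have hph1 : pI p 1 (1 + ph p) := by
    convert pI_add hp hph (hc_one_cong hp) using 1
    ring
  have hphi : pI p 0 (ph p) := pI_nat hp _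
  have hn1 : pI p 2 (hc p (n - 1)) :=
    hc_dvd_sq hp hp2 _ (by omega) (by
      obtain ⟨a, ha⟩ := hp2
      obtain ⟨b, hb⟩ := hodd
      omega) (Nat.Odd.sub_odd hodd odd_one)
  have hg : pI p 1 (n * hc p n / p - bernoulli' (p - n)) := by
    have h := glaisher hp (p - n) (by omega) (by omega)
    rwa [show p - (p - n) = n by omega] at h
  have hdn : pI p 3 (dc p (n - 1) - (hc p (n - 1) + n * p * hc p n)) := by
    have h := dc_cong hp (n - 1) (by omega)
    rw [show n - 1 + 1 = n by omega, show n - 1 + 2 = n + 1 by omega] at h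
    have h2 := pI_mul0 hp (pI_nat hp ((n + 1).choose (n - 1)))
      (pI_mul hp (pI_pow (s := 2) hp 2 le_rfl) (hc_dvd hp (n + 1) (by omega) hpn))
    convert pI_add hp h h2 using 1
    rw [Nat.cast_sub (by omega)]
    push_cast
    ring
  -- the middle terms
  have hmid : pI p 3 (∑ i ∈ Finset.range (n - 3), hc p (i + 2) * dc p (n - (i + 2))) := by
    apply pI_sum hp
    intro i hi
    have hi' := Finset.mem_range.mp hi
    have hd : ∀ j, 2 ≤ j → j ≤ n - 2 →  pI p 2 (dc p j - hc p j) := by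
      intro j hj1 hj2
      have h := dc_cong hp j (by omega)
      have h2 := pI_mul hp (pI_mul0 hp (pI_nat hp (j + 1)) (pI_p hp))
        (hc_dvd hp (j + 1) (by omega) (by omega))
      have h3 := pI_mul hp (pI_mul0 hp (pI_nat hp ((j + 2).choose j))
        (pI_pow (s := 2) hp 2 (by omega))) (hc_int hp (j + 2))
      convert pI_add hp (pI_add hp (pI_mono (by omega : 2 ≤ 3) h) h2) h3 using 1
      push_cast
      ring
    have hdi := hd (n - (i + 2)) (by omega) (by omega)
    rcases Nat.even_or_odd i with hie | hio
    · have h1 := hc_dvd_sq hp hp2 (i + 2) (by omega) (by omega) (by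
        rw [Nat.even_add]; simp [hie])
      have h2 := pI_add hp (pI_mono (by omega : 1 ≤ 2) hdi)
        (hc_dvd hp (n - (i + 2)) (by omega) (by omega))
      rw [sub_add_cancel] at h2
      exact pI_mul hp h1 h2
    · have h1 := hc_dvd hp (i + 2) (by omega) (by omega)
      have h2 := pI_add hp hdi
        (hc_dvd_sq hp hp2 (n - (i + 2)) (by omega) (by omega)
          (Nat.Odd.sub_odd hodd (by rw [Nat.odd_add]; simp [hio])))
      rw [sub_add_cancel] at h2
      exact pI_mul hp h1 h2
  have hC : (ascPochhammer ℚ (2 * p)).coeff n = hc p 1 * dc p (n - 1) +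
      (∑ i ∈ Finset.range (n - 3), hc p (i + 2) * dc p (n - (i + 2))) +
      hc p (n - 1) * dc p 1 + hc p n * (p * ph p) := by
    rw [coeff_asc_two, Finset.sum_range_succ]
    obtain ⟨m, rfl⟩ : ∃ m, n = m + 3 := ⟨n - 3, by omega⟩
    rw [Finset.sum_range_succ, Finset.sum_range_succ', Finset.sum_range_succ']
    simp only [hc_zero hp, zero_mul, add_zero, Nat.sub_self, dc_zero' hp]
    simp only [Nat.add_sub_cancel, show m + 3 - 1 = m + 2 by omega,
      show m + 3 - (m + 2) = 1 by omega, zero_add]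
    ring
  rw [hC]
  have k1 := pI_mul0 hp (hc_int hp 1) hdn
  have k2 := pI_mul hp hn1 (pI_sub hp hd1 (pI_add hp hph hph))
  have k3 := pI_mul0 hp (hc_int hp 1) (pI_mul hp (pI_pow (s := 2) hp 2 le_rfl) hg)
  have k4 := pI_mul hp (pI_mul0 hp (hc_int hp 1) (pI_pow (s := 2) hp 2 le_rfl))
    (pI_mul0 hp hBi hph1)
  convert pI_neg (pI_add hp (pI_add hp (pI_add hp k1 k2) (pI_add hp k3 k4)) hmid) using 1
  field_simp
  ring

lemma final_cong {p n : ℕ} (hp : p.Prime) (hn : 3 ≤ n) (hodd : Odd n) (hpn : n + 1 < p) (Z1 Z2 : ℚ)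
    (h1 : Z1 * p.factorial = n.factorial * hc p n)
    (h2 : Z2 = n.factorial * (ascPochhammer ℚ (2 * p)).coeff n / (2 * p).factorial -
      n / p * ((n - 1).factorial * hc p (n - 1) / p.factorial)) :
    pI p 1 (Z1 / 2 - Z2 - n.factorial / 2 * bernoulli (p - n)) := by
  have hp0 : (p : ℚ) ≠ 0 := by exact_mod_cast hp.ne_zero
  have hb := bracket hp hn hodd hpn
  have hh : hc p 1 ≠ 0 := by rw [hc_one hp]; exact_mod_cast Nat.factorial_ne_zero _
  have hph : ph p ≠ 0 := by
    unfold ph; exact_mod_cast (Nat.ascFactorial_pos _ _).ne'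
  have hpf : (p.factorial : ℚ) = p * hc p 1 := by
    rw [hc_one hp, ← Nat.cast_mul, Nat.mul_factorial_pred hp.ne_zero]
  have hnf : (n.factorial : ℚ) = n * (n - 1).factorial := by
    rw [← Nat.cast_mul, Nat.mul_factorial_pred (by omega)]
  apply pI_cancel_nat hp 2 (fun hd => by have := Nat.le_of_dvd (by omega) hd; omega)
  apply pI_cancel_nat hp (p - 1).factorial (fun hd => by
    rw [hp.dvd_factorial] at hd; have := hp.pos; omega)
  apply pI_cancel_nat hp ((p + 1).ascFactorial (p - 1)) (fun hd => by
    rw [Nat.ascFactorial_eq_prod_range, hp.prime.dvd_finsetProd_iff] at hd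
    obtain ⟨i, hi, hd⟩ := hd
    have hi' := Finset.mem_range.mp hi
    rw [add_assoc, Nat.dvd_add_right dvd_rfl] at hd
    have := Nat.le_of_dvd (by omega) hd
    omega)
  apply pI_cancel_p hp 2
  convert pI_mul0 hp (pI_nat hp n.factorial) hb using 1
  rw [← hc_one hp]
  change (p : ℚ) ^ 2 * (ph p * _) = _
  have hZ1 : Z1 = n.factorial * hc p n / (p * hc p 1) := by
    rw [← hpf, eq_div_iff, h1]
    rw [hpf]; positivity
  rw [h2, hZ1, fact_two hp, hpf, hnf]
  push_cast
  field_simp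
  ring

/-- The series `∑ x^l / l = -log(1-x)`. -/
noncomputable def ell : PowerSeries ℚ := PowerSeries.mk fun l => (l : ℚ)⁻¹

/-- The series `∑_{p ∤ l} x^l / l`. -/
noncomputable def Pser (p : ℕ) : PowerSeries ℚ :=
  PowerSeries.mk fun l => if p ∣ l then 0 else (l : ℚ)⁻¹

/-- The series `∑_{p ∤ l} (-x)^l / l`. -/
noncomputable def Mser (p : ℕ) : PowerSeries ℚ := PowerSeries.rescale (-1) (Pser p)

lemma ell_deriv (n : ℕ) : (1 - PowerSeries.X) * PowerSeries.derivative ℚ (ell ^ (n + 1)) =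
    ((n + 1 : ℕ) : PowerSeries ℚ) * ell ^ n := by
  have h : PowerSeries.derivative ℚ ell = PowerSeries.mk 1 := by
    ext k
    rw [PowerSeries.coeff_derivative]
    simp [ell]
    field_simp
  rw [PowerSeries.derivative_pow, h]
  have := PowerSeries.mk_one_mul_one_sub_eq_one ℚ
  simp only [Nat.add_sub_cancel]
  linear_combination (((n + 1 : ℕ) : PowerSeries ℚ) * ell ^ n) * this

lemma ell_rec (n N : ℕ) : ((N : ℚ) + 1) * PowerSeries.coeff (N + 1) (ell ^ (n + 1)) =
    N * PowerSeries.coeff N (ell ^ (n + 1)) + (n + 1) * PowerSeries.coeff N (ell ^ n) := by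
  have h := congrArg (PowerSeries.coeff N) (ell_deriv n)
  rw [sub_mul, one_mul, map_sub, PowerSeries.coeff_derivative] at h
  have h2 : PowerSeries.coeff N (((n + 1 : ℕ) : PowerSeries ℚ) * ell ^ n) =
      (n + 1) * PowerSeries.coeff N (ell ^ n) := by
    rw [← map_natCast (PowerSeries.C (R := ℚ)), PowerSeries.coeff_C_mul]; push_cast; ring
  rw [h2] at h
  cases N with
  | zero =>
    simp only [PowerSeries.coeff_zero_X_mul] at h
    push_cast at h ⊢
    linear_combination h
  | succ M =>
    rw [PowerSeries.coeff_succ_X_mul, PowerSeries.coeff_derivative] at h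
    push_cast at h ⊢
    linear_combination h

lemma ell_coeff (N n : ℕ) : PowerSeries.coeff N (ell ^ n) * N.factorial =
    n.factorial * (ascPochhammer ℚ N).coeff n := by
  induction N generalizing n with
  | zero =>
    cases n with
    | zero => simp
    | succ n => simp [Polynomial.coeff_one, ell]
  | succ N ih =>
    cases n with
    | zero =>
      rw [Polynomial.coeff_zero_eq_eval_zero, ascPochhammer_eval_zero]
      simp [PowerSeries.coeff_one]
    | succ n =>
      have h1 := ih n
      have h2 := ih (n + 1)
      have h := ell_rec n N
      rw [ascPochhammer_succ_right, mul_add, Polynomial.coeff_add, Polynomial.coeff_mul_X,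
        Polynomial.coeff_mul_natCast]
      rw [Nat.factorial_succ] at h2 ⊢
      rw [Nat.factorial_succ]
      push_cast at h2 ⊢
      linear_combination (N.factorial : ℚ) * h + N * h2 + (n + 1) * h1

lemma Pser_X (p : ℕ) : ∃ P1, Pser p = PowerSeries.X * P1 := by
  have : (PowerSeries.X : PowerSeries ℚ) ∣ Pser p := by
    rw [PowerSeries.X_dvd_iff]; simp [Pser]
  exact this

lemma ell_split {p : ℕ} (hp : p.Prime) : ∃ Q : PowerSeries ℚ,
    ell = Pser p + PowerSeries.X ^ p * (PowerSeries.C ((p : ℚ)⁻¹) + PowerSeries.X ^ p * Q) := by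
  have : (PowerSeries.X : PowerSeries ℚ) ^ (p + p) ∣
      ell - Pser p - PowerSeries.X ^ p * PowerSeries.C ((p : ℚ)⁻¹) := by
    rw [PowerSeries.X_pow_dvd_iff]
    intro m hm
    rw [map_sub, map_sub, PowerSeries.coeff_mul_C, PowerSeries.coeff_X_pow]
    simp only [ell, Pser, PowerSeries.coeff_mk]
    by_cases hd : p ∣ m
    · obtain ⟨c, rfl⟩ := hd
      have hc : c < 2 := by
        by_contra hc
        have : p * 2 ≤ p * c := Nat.mul_le_mul_left _ (by omega)
        omega
      interval_cases c
      · simp [hp.ne_zero.symm]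
      · simp
    · rw [if_neg hd, if_neg (by rintro rfl; exact hd dvd_rfl)]; simp
  obtain ⟨Q, hQ⟩ := this
  refine ⟨Q, ?_⟩
  rw [pow_add] at hQ
  linear_combination hQ

lemma coeff_X_pow_mul_zero (F : PowerSeries ℚ) (a N : ℕ) (h : N < a) :
    PowerSeries.coeff N (PowerSeries.X ^ a * F) = 0 := by
  rw [PowerSeries.coeff_X_pow_mul', if_neg (by omega)]

lemma P_coeff_p {p n : ℕ} (hp : p.Prime) (hn : 2 ≤ n) :
    PowerSeries.coeff p (Pser p ^ n) = PowerSeries.coeff p (ell ^ n) := by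
  obtain ⟨P1, hP⟩ := Pser_X p
  obtain ⟨Q, hQ⟩ := ell_split hp
  generalize hR : PowerSeries.C ((p : ℚ)⁻¹) + PowerSeries.X ^ p * Q = R at hQ
  rw [hQ, add_pow, Finset.sum_range_succ, map_add]
  simp only [Nat.sub_self, pow_zero, mul_one, Nat.choose_self, Nat.cast_one]
  rw [right_eq_add, map_sum]
  apply Finset.sum_eq_zero
  intro m hm
  have hm' := Finset.mem_range.mp hm
  have : Pser p ^ m * (PowerSeries.X ^ p * R) ^ (n - m) * (n.choose m : PowerSeries ℚ) =
      PowerSeries.X ^ (m + p * (n - m)) * (P1 ^ m * R ^ (n - m) * (n.choose m : PowerSeries ℚ)) := by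
    rw [hP, pow_add, pow_mul]; ring
  rw [this]
  apply coeff_X_pow_mul_zero
  have hp1 := hp.two_le
  rcases Nat.eq_zero_or_pos m with h0 | h0
  · subst h0
    have : p * 2 ≤ p * (n - 0) := Nat.mul_le_mul_left _ (by omega)
    omega
  · have : p * 1 ≤ p * (n - m) := Nat.mul_le_mul_left _ (by omega)
    omega

lemma P_coeff_2p {p n : ℕ} (hp : p.Prime) (hn : 3 ≤ n) :
    PowerSeries.coeff (2 * p) (ell ^ n) = PowerSeries.coeff (2 * p) (Pser p ^ n) +
      n / p * PowerSeries.coeff p (Pser p ^ (n - 1)) := by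
  obtain ⟨P1, hP⟩ := Pser_X p
  obtain ⟨Q, hQ⟩ := ell_split hp
  generalize hR : PowerSeries.C ((p : ℚ)⁻¹) + PowerSeries.X ^ p * Q = R at hQ
  obtain ⟨k, rfl⟩ : ∃ k, n = k + 1 := ⟨n - 1, by omega⟩
  rw [hQ, add_pow, Finset.sum_range_succ, Finset.sum_range_succ, map_add, map_add]
  simp only [Nat.sub_self, pow_zero, mul_one, Nat.choose_self, Nat.cast_one]
  have hz : PowerSeries.coeff (2 * p) (∑ x ∈ Finset.range k,
      Pser p ^ x * (PowerSeries.X ^ p * R) ^ (k + 1 - x) * ((k + 1).choose x : PowerSeries ℚ)) = 0 := by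
    rw [map_sum]
    apply Finset.sum_eq_zero
    intro m hm
    have hm' := Finset.mem_range.mp hm
    have : Pser p ^ m * (PowerSeries.X ^ p * R) ^ (k + 1 - m) *
          ((k + 1).choose m : PowerSeries ℚ) =
        PowerSeries.X ^ (m + p * (k + 1 - m)) *
          (P1 ^ m * R ^ (k + 1 - m) * ((k + 1).choose m : PowerSeries ℚ)) := by
      rw [hP, pow_add, pow_mul]; ring
    rw [this]
    apply coeff_X_pow_mul_zero
    have hp1 := hp.two_le
    rcases Nat.eq_zero_or_pos m with h0 | h0
    · subst h0
      have : p * 3 ≤ p * (k + 1 - 0) := Nat.mul_le_mul_left _ (by omega)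
      omega
    · have : p * 2 ≤ p * (k + 1 - m) := Nat.mul_le_mul_left _ (by omega)
      omega
  rw [hz, zero_add, add_comm]
  congr 1
  have e : Pser p ^ k * (PowerSeries.X ^ p * R) ^ (k + 1 - k) * ((k + 1).choose k : PowerSeries ℚ) =
      PowerSeries.X ^ p * (PowerSeries.C ((k + 1 : ℕ) / (p : ℚ)) * Pser p ^ k) +
      PowerSeries.X ^ (p + p + k) * (P1 ^ k * Q * ((k + 1).choose k : PowerSeries ℚ)) := by
    rw [show k + 1 - k = 1 by omega, ← hR, Nat.choose_succ_self_right, div_eq_mul_inv,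
      map_mul, map_natCast, hP, pow_add, pow_add]
    ring
  rw [e, map_add, coeff_X_pow_mul_zero _ (p + p + k) _ (by omega), add_zero, two_mul,
    PowerSeries.coeff_X_pow_mul, PowerSeries.coeff_C_mul]
  simp

lemma sum_antidiagonalTuple_prod (n N : ℕ) (f : Fin n → ℕ → ℚ) :
    ∑ l ∈ Finset.Nat.antidiagonalTuple n N, ∏ i, f i (l i) =
      PowerSeries.coeff N (∏ i, PowerSeries.mk (f i)) := by
  rw [PowerSeries.coeff_prod, ← Finset.piAntidiag_univ_fin_eq_antidiagonalTuple]
  rw [Finset.finsuppAntidiag]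
  simp only [PowerSeries.coeff_mk, Finset.sum_map, Function.Embedding.coeFn_mk,
    Finsupp.coe_mk]
  exact (Finset.sum_attach _ (fun l : Fin n → ℕ => ∏ i, f i (l i))).symm

lemma sigma_coeff (p n b N : ℕ) (hb : b ≤ n) :
    sigmaSum p n b N = PowerSeries.coeff N (Mser p ^ b * Pser p ^ (n - b)) := by
  have h : ∏ i : Fin n, PowerSeries.mk (fun l => (if (i : ℕ) < b then (-1 : ℚ) ^ l else 1) *
      (if p ∣ l then 0 else (l : ℚ)⁻¹)) = Mser p ^ b * Pser p ^ (n - b) := by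
    have h1 : ∀ i : Fin n, PowerSeries.mk (fun l => (if (i : ℕ) < b then (-1 : ℚ) ^ l else 1) *
      (if p ∣ l then 0 else (l : ℚ)⁻¹)) = if (i : ℕ) < b then Mser p else Pser p := by
      intro i
      ext l
      split_ifs <;> simp [Mser, Pser, PowerSeries.coeff_rescale]
    rw [Finset.prod_congr rfl fun i _ => h1 i,
      Fin.prod_univ_eq_prod_range (fun i => if i < b then Mser p else Pser p) n]
    obtain ⟨c, rfl⟩ := Nat.exists_eq_add_of_le hb
    rw [Finset.prod_range_add, Nat.add_sub_cancel_left]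
    congr 1
    · rw [Finset.prod_congr rfl (g := fun _ => Mser p)]
      · simp
      · intro x hx; rw [if_pos (Finset.mem_range.mp hx)]
    · simp
  rw [← h, ← sum_antidiagonalTuple_prod, sigmaSum, Finset.sum_filter]
  refine Finset.sum_congr rfl fun l _ => ?_
  split_ifs with hc
  · rw [Finset.prod_mul_distrib]
    congr 1
    · rw [← Finset.prod_pow_eq_pow_sum, Finset.prod_filter]
    · exact Finset.prod_congr rfl fun i _ => by rw [if_neg (hc i).2]
  · push Not at hc
    obtain ⟨i, hi⟩ := hc
    symm
    apply Finset.prod_eq_zero (Finset.mem_univ i)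
    have hd : p ∣ l i := by
      rcases Nat.eq_zero_or_pos (l i) with h0 | h0
      · rw [h0]; simp
      · exact hi h0
    rw [if_pos hd, mul_zero]

lemma coeff_symm (p a b N : ℕ) (hN : Even N) :
    PowerSeries.coeff N (Mser p ^ a * Pser p ^ b) =
    PowerSeries.coeff N (Mser p ^ b * Pser p ^ a) := by
  have h : PowerSeries.rescale (-1 : ℚ) (Mser p) = Pser p := by
    unfold Mser
    rw [PowerSeries.rescale_rescale]; simp
  have h2 : PowerSeries.rescale (-1 : ℚ) (Mser p ^ b * Pser p ^ a) = Mser p ^ a * Pser p ^ b := by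
    rw [map_mul, map_pow, map_pow, h, ← Mser]; ring
  rw [← h2, PowerSeries.coeff_rescale, hN.neg_one_pow, one_mul]

lemma MP_expand {p : ℕ} (hp : p.Prime) (hp2 : p ≠ 2) :
    Mser p + Pser p = PowerSeries.expand 2 two_ne_zero (Pser p) := by
  ext l
  rw [PowerSeries.coeff_expand, map_add, Mser, PowerSeries.coeff_rescale]
  simp only [Pser, PowerSeries.coeff_mk]
  by_cases he : 2 ∣ l
  · obtain ⟨c, rfl⟩ := he
    rw [if_pos (dvd_mul_right 2 c), Nat.mul_div_cancel_left c two_pos,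
      (even_two_mul c).neg_one_pow]
    have hiff : p ∣ 2 * c ↔ p ∣ c := by
      rw [hp.dvd_mul]
      constructor
      · rintro (h | h)
        · exact absurd ((Nat.prime_dvd_prime_iff_eq hp Nat.prime_two).mp h) hp2
        · exact h
      · exact Or.inr
    by_cases hc : p ∣ c
    · rw [if_pos (hiff.mpr hc), if_pos hc]; simp
    · rw [if_neg (fun h => hc (hiff.mp h)), if_neg hc]
      push_cast
      rw [mul_inv]; ring
  · rw [if_neg he, Odd.neg_one_pow (by rw [← Nat.not_even_iff_odd, even_iff_two_dvd]; exact he)]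
    ring

theorem sigma_total {p n : ℕ} (hp : p.Prime) (hp2 : p ≠ 2) (hodd : Odd n) :
    ∑ b ∈ Finset.Icc 1 (n / 2), (n.choose b : ℚ) * sigmaSum p n b (2 * p) =
      PowerSeries.coeff p (Pser p ^ n) / 2 - PowerSeries.coeff (2 * p) (Pser p ^ n) := by
  have hall : ∑ b ∈ Finset.range (n + 1), (n.choose b : ℚ) *
      PowerSeries.coeff (2 * p) (Mser p ^ b * Pser p ^ (n - b)) =
      PowerSeries.coeff p (Pser p ^ n) := by
    rw [← PowerSeries.coeff_expand_mul 2 two_ne_zero, map_pow, ← MP_expand hp hp2, add_pow, map_sum]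
    refine Finset.sum_congr rfl fun b _ => ?_
    rw [← map_natCast (PowerSeries.C (R := ℚ)), PowerSeries.coeff_mul_C, mul_comm]
  obtain ⟨k, rfl⟩ := hodd
  rw [show 2 * k + 1 + 1 = (k + 1) + (k + 1) by ring, Finset.sum_range_add] at hall
  have hrefl : ∑ x ∈ Finset.range (k + 1), ((2 * k + 1).choose (k + 1 + x) : ℚ) *
      PowerSeries.coeff (2 * p) (Mser p ^ (k + 1 + x) * Pser p ^ (2 * k + 1 - (k + 1 + x))) =
      ∑ x ∈ Finset.range (k + 1), ((2 * k + 1).choose x : ℚ) *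
      PowerSeries.coeff (2 * p) (Mser p ^ x * Pser p ^ (2 * k + 1 - x)) := by
    rw [← Finset.sum_range_reflect]
    refine Finset.sum_congr rfl fun x hx => ?_
    have hx' := Finset.mem_range.mp hx
    rw [coeff_symm _ _ _ _ (even_two_mul p), show k + 1 + (k + 1 - 1 - x) = 2 * k + 1 - x by omega,
      show 2 * k + 1 - (2 * k + 1 - x) = x by omega, Nat.choose_symm (by omega)]
  rw [hrefl] at hall
  rw [Finset.sum_range_succ'] at hall
  simp only [Nat.choose_zero_right, pow_zero, Nat.sub_zero, one_mul, Nat.cast_one] at hall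
  have e : ∑ b ∈ Finset.Icc 1 ((2 * k + 1) / 2), ((2 * k + 1).choose b : ℚ) *
      sigmaSum p (2 * k + 1) b (2 * p) =
      ∑ x ∈ Finset.range k, ((2 * k + 1).choose (x + 1) : ℚ) *
      PowerSeries.coeff (2 * p) (Mser p ^ (x + 1) * Pser p ^ (2 * k + 1 - (x + 1))) := by
    rw [show (2 * k + 1) / 2 = k by omega, ← Finset.Ico_add_one_right_eq_Icc,
      Finset.sum_Ico_eq_sum_range]
    refine Finset.sum_congr (by simp) fun x hx => ?_
    have hx' := Finset.mem_range.mp hx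
    rw [sigma_coeff _ _ _ _ (by omega), add_comm 1 x]
  rw [e]
  linarith

theorem stmt12 (n : ℕ) (hn : 3 ≤ n) (hodd : Odd n) (p : ℕ) (hp : p.Prime)
    (hpn : n + 1 < p) :
    padicCong p 1
      (∑ b ∈ Finset.Icc 1 (n / 2), (n.choose b : ℚ) * sigmaSum p n b (2 * p))
      ((n.factorial : ℚ) / 2 * bernoulli (p - n)) := by
  have hfin := final_cong hp hn hodd hpn (PowerSeries.coeff p (Pser p ^ n))
    (PowerSeries.coeff (2 * p) (Pser p ^ n))
    (by rw [P_coeff_p hp (by omega), ell_coeff]; rfl)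
    (by
      have h := P_coeff_2p hp hn
      rw [P_coeff_p hp (by omega : 2 ≤ n - 1)] at h
      have h1 := ell_coeff (2 * p) n
      have h2 := ell_coeff p (n - 1)
      rw [← eq_div_iff (by exact_mod_cast Nat.factorial_ne_zero _)] at h1 h2
      rw [h1, h2] at h
      unfold hc
      linarith)
  rw [← sigma_total hp (by omega) hodd] at hfin
  rcases pI_val hp hfin with h | h
  · exact Or.inl (by linarith)
  · exact Or.inr h
end
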